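/- Fix d ≥ 1, T > 0, a compact interval Θ = [θ_min, θ_max] ⊂ (0,∞), a link function Φ, an integer β > 2 + d/2, and a smooth ℤ^d-periodic initial value u_0 with u_0 ≥ u_{0,min} > 0. Fix θ₀ ∈ Θ, a smooth ℤ^d-periodic F₀, and let u* be a smooth classical solution with diffusivity θ₀, absorption Φ∘F₀ and initial value u_0. Assume u_0 does not lie in an eigenspace of the Schrödinger operator S_{θ₀,F₀}, i.e. there is no λ ∈ ℝ with (θ₀/2)Δ_x u_0 − Φ(F₀) u_0 = λ u_0 on ℝ^d. Then for every R > 0 there exist L > 0 and δ₀ > 0 such that for all 0 < δ ≤ δ₀: for every θ ∈ Θ, every smooth ℤ^d-periodic F with ‖F‖_{H^β(𝕋^d)} ≤ R, and every smooth classical solution u with diffusivity θ, absorption Φ∘F and initial value u_0, the inequality ‖u − u*‖_{L²(Q)} ≤ δ implies |θ − θ₀| + ‖F − F₀‖_{L²(𝕋^d)} ≤ L δ^{β/(β+2)}. (Lemma 'Stability Estimate'.) -/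

import Mathlib

open MeasureTheory Real Filter

noncomputable section

/-- Partial derivative in the `i`-th spatial coordinate. -/
def pder {d : ℕ} (i : Fin d) (v : (Fin d → ℝ) → ℝ) : (Fin d → ℝ) → ℝ :=
  fun x => deriv (fun s => v (Function.update x i s)) (x i)

/-- Spatial Laplacian `Δ_x = ∑ᵢ ∂²/∂xᵢ²`. -/
def lap {d : ℕ} (v : (Fin d → ℝ) → ℝ) : (Fin d → ℝ) → ℝ :=
  fun x => ∑ i : Fin d, pder i (pder i v) x

/-- Multi-index spatial derivative `∂^j`. -/
def mder {d : ℕ} (j : Fin d → ℕ) (v : (Fin d → ℝ) → ℝ) : (Fin d → ℝ) → ℝ :=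
  (List.finRange d).foldr (fun i acc => (pder i)^[j i] acc) v

/-- `ℤ^d`-periodicity of a function on `ℝ^d`. -/
def ZPer {d : ℕ} (F : (Fin d → ℝ) → ℝ) : Prop :=
  ∀ (x : Fin d → ℝ) (k : Fin d → ℤ), F (fun i => x i + (k i : ℝ)) = F x

/-- `ℤ^d`-periodicity in the space variable. -/
def ZPerSpace {d : ℕ} (u : (Fin d → ℝ) → ℝ → ℝ) : Prop :=
  ∀ t : ℝ, ZPer fun x => u x t

/-- The fundamental domain `[0,1]^d` of the torus. -/
def unitCube (d : ℕ) : Set (Fin d → ℝ) := Set.Icc 0 1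

/-- `L²`-norm on the torus. -/
def l2T {d : ℕ} (F : (Fin d → ℝ) → ℝ) : ℝ :=
  Real.sqrt (∫ x in unitCube d, (F x) ^ 2)

/-- `L²`-norm on `Q = 𝕋^d × (0,T)`. -/
def l2Q {d : ℕ} (T : ℝ) (u : (Fin d → ℝ) → ℝ → ℝ) : ℝ :=
  Real.sqrt (∫ t in Set.Ioc (0 : ℝ) T, ∫ x in unitCube d, (u x t) ^ 2)

/-- Supremum norm over space. -/
def supT {d : ℕ} (F : (Fin d → ℝ) → ℝ) : ℝ := ⨆ x, |F x|

/-- Supremum norm over `𝕋^d × [0,T]`. -/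
def supQ {d : ℕ} (T : ℝ) (u : (Fin d → ℝ) → ℝ → ℝ) : ℝ :=
  ⨆ x, ⨆ t ∈ Set.Icc (0 : ℝ) T, |u x t|

/-- Squared Sobolev `H^β`-norm on the torus:  `∑_{|j| ≤ β} ‖∂^j F‖²_{L²(𝕋^d)}`. -/
def hSobSq {d : ℕ} (β : ℕ) (F : (Fin d → ℝ) → ℝ) : ℝ :=
  ∑ j ∈ Finset.univ.filter (fun j : Fin d → Fin (β + 1) => (∑ i, (j i : ℕ)) ≤ β),
    ∫ x in unitCube d, (mder (fun i => (j i : ℕ)) F x) ^ 2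

/-- Sobolev `H^β`-norm on the torus. -/
def hSob {d : ℕ} (β : ℕ) (F : (Fin d → ℝ) → ℝ) : ℝ := Real.sqrt (hSobSq β F)

/-- Squared parabolic Sobolev `H^{2,1}(Q)`-norm. -/
def h21Sq {d : ℕ} (T : ℝ) (u : (Fin d → ℝ) → ℝ → ℝ) : ℝ :=
  (∫ t in Set.Ioc (0 : ℝ) T,
      ∑ j ∈ Finset.univ.filter (fun j : Fin d → Fin 3 => (∑ i, (j i : ℕ)) ≤ 2),
        ∫ x in unitCube d, (mder (fun i => (j i : ℕ)) (fun y => u y t) x) ^ 2)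
    + ∫ x in unitCube d, ∫ t in Set.Ioc (0 : ℝ) T, ((u x t) ^ 2 + (deriv (u x) t) ^ 2)

/-- Parabolic Sobolev `H^{2,1}(Q)`-norm. -/
def h21 {d : ℕ} (T : ℝ) (u : (Fin d → ℝ) → ℝ → ℝ) : ℝ := Real.sqrt (h21Sq T u)

/-- Smoothness of a function of space and time. -/
def SmoothQ {d : ℕ} (u : (Fin d → ℝ) → ℝ → ℝ) : Prop :=
  ContDiff ℝ (⊤ : ℕ∞) fun p : (Fin d → ℝ) × ℝ => u p.1 p.2

/-- A smooth classical solution of the heat equation with absorption `f`,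
diffusivity `θ` and initial value `u0`. -/
def HeatSol {d : ℕ} (T θ : ℝ) (f u0 : (Fin d → ℝ) → ℝ) (u : (Fin d → ℝ) → ℝ → ℝ) : Prop :=
  SmoothQ u ∧ ZPerSpace u ∧
    (∀ (x : Fin d → ℝ), ∀ t ∈ Set.Ioc (0 : ℝ) T,
      deriv (u x) t = θ / 2 * lap (fun y => u y t) x - f x * u x t) ∧
    ∀ x, u x 0 = u0 x

/-- A smooth solution of the inhomogeneous problem with forcing `g` and
zero initial value (`v = 𝓛_{θ,f}⁻¹ g`). -/
def InhomSol {d : ℕ} (T θ : ℝ) (f : (Fin d → ℝ) → ℝ) (g v : (Fin d → ℝ) → ℝ → ℝ) : Prop :=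
  SmoothQ v ∧ ZPerSpace v ∧
    (∀ (x : Fin d → ℝ), ∀ t ∈ Set.Ioc (0 : ℝ) T,
      deriv (v x) t = θ / 2 * lap (fun y => v y t) x - f x * v x t + g x t) ∧
    ∀ x, v x 0 = 0

/-- A link function: a smooth function `Φ : ℝ → (fmin, ∞)` with strictly positive
derivative and all derivatives bounded. -/
structure LinkFun where
  toFun : ℝ → ℝ
  fmin : ℝ
  fmin_pos : 0 < fmin
  smooth : ContDiff ℝ (⊤ : ℕ∞) toFun
  gt_fmin : ∀ x, fmin < toFun x
  deriv_pos : ∀ x, 0 < deriv toFun x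
  derivs_bdd : ∀ n : ℕ, 1 ≤ n → ∃ C, ∀ x, |iteratedDeriv n toFun x| ≤ C

/-- The linearized solution `I_{θ,F} h` in direction `h`, associated with a solution `u`. -/
def LinSol {d : ℕ} (T θ : ℝ) (Φ : LinkFun) (F h : (Fin d → ℝ) → ℝ)
    (u z : (Fin d → ℝ) → ℝ → ℝ) : Prop :=
  SmoothQ z ∧ ZPerSpace z ∧
    (∀ (x : Fin d → ℝ), ∀ t ∈ Set.Ioc (0 : ℝ) T,
      deriv (z x) t = θ / 2 * lap (fun y => z y t) x - Φ.toFun (F x) * z x t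
        + h x * deriv Φ.toFun (F x) * u x t) ∧
    ∀ x, z x 0 = 0

/-- The `θ`-derivative solution `K̇_θ F`, associated with a solution `u`. -/
def ThetaDerivSol {d : ℕ} (T θ : ℝ) (Φ : LinkFun) (F : (Fin d → ℝ) → ℝ)
    (u w : (Fin d → ℝ) → ℝ → ℝ) : Prop :=
  SmoothQ w ∧ ZPerSpace w ∧
    (∀ (x : Fin d → ℝ), ∀ t ∈ Set.Ioc (0 : ℝ) T,
      deriv (w x) t = θ / 2 * lap (fun y => w y t) x - Φ.toFun (F x) * w x t
        + 1 / 2 * lap (fun y => u y t) x) ∧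
    ∀ x, w x 0 = 0

/-- Dual Sobolev norm `‖G‖_{(H²)*}` on the torus. -/
def h2dual {d : ℕ} (G : (Fin d → ℝ) → ℝ) : ℝ :=
  sSup {r : ℝ | ∃ g : (Fin d → ℝ) → ℝ, ContDiff ℝ (⊤ : ℕ∞) g ∧ ZPer g ∧ hSob 2 g ≤ 1 ∧
    r = |∫ x in unitCube d, G x * g x|}

end

section Calculus

variable {d : ℕ}

lemma pder_eq_fderiv {v : (Fin d → ℝ) → ℝ} {x : Fin d → ℝ} (h : DifferentiableAt ℝ v x)
    (i : Fin d) : pder i v x = fderiv ℝ v x (Pi.single i 1) := by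
  have h1 := hasDerivAt_update x i (x i)
  have h2 : HasFDerivAt v (fderiv ℝ v x) (Function.update x i (x i)) := by
    rw [Function.update_eq_self]; exact h.hasFDerivAt
  exact (h2.comp_hasDerivAt _ h1).deriv

lemma contDiff_pder {v : (Fin d → ℝ) → ℝ} (h : ContDiff ℝ (⊤ : ℕ∞) v) (i : Fin d) :
    ContDiff ℝ (⊤ : ℕ∞) (pder i v) := by
  have h1 : pder i v = fun x => fderiv ℝ v x (Pi.single i 1) := by
    funext x
    exact pder_eq_fderiv (h.differentiable (by simp) x) i
  rw [h1]
  exact (h.fderiv_right (m := (⊤ : ℕ∞)) (by simp)).clm_apply contDiff_const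

lemma ZPer.pder {v : (Fin d → ℝ) → ℝ} (h : ZPer v) (i : Fin d) : ZPer (pder i v) := by
  intro x k
  have h1 : (fun s => v (Function.update x i s)) =
      fun s => v (Function.update (fun j => x j + (k j : ℝ)) i (s + k i)) := by
    funext s
    rw [← h (Function.update x i s) k]
    congr 1
    funext j
    by_cases hj : j = i
    · subst hj; simp
    · simp [hj]
  unfold _root_.pder
  rw [h1, deriv_comp_add_const (fun s => v (Function.update (fun j => x j + (k j : ℝ)) i s))]

lemma ZPer.lap {v : (Fin d → ℝ) → ℝ} (h : ZPer v) : ZPer (lap v) := by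
  intro x k
  exact Finset.sum_congr rfl fun i _ => (h.pder i).pder i x k

lemma pder_mul {v w : (Fin d → ℝ) → ℝ} (hv : ContDiff ℝ (⊤ : ℕ∞) v)
    (hw : ContDiff ℝ (⊤ : ℕ∞) w) (i : Fin d) (x : Fin d → ℝ) :
    pder i (fun y => v y * w y) x = pder i v x * w x + v x * pder i w x := by
  have hv' := hv.differentiable (by simp) x
  have hw' := hw.differentiable (by simp) x
  rw [pder_eq_fderiv (hv'.fun_mul hw'), pder_eq_fderiv hv', pder_eq_fderiv hw',
    fderiv_fun_mul hv' hw']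
  simp
  ring

lemma pder_sub {v w : (Fin d → ℝ) → ℝ} (hv : ContDiff ℝ (⊤ : ℕ∞) v)
    (hw : ContDiff ℝ (⊤ : ℕ∞) w) (i : Fin d) (x : Fin d → ℝ) :
    pder i (fun y => v y - w y) x = pder i v x - pder i w x := by
  have hv' := hv.differentiable (by simp) x
  have hw' := hw.differentiable (by simp) x
  rw [pder_eq_fderiv (hv'.fun_sub hw'), pder_eq_fderiv hv', pder_eq_fderiv hw',
    fderiv_fun_sub hv' hw']
  simp

lemma lap_sub {v w : (Fin d → ℝ) → ℝ} (hv : ContDiff ℝ (⊤ : ℕ∞) v)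
    (hw : ContDiff ℝ (⊤ : ℕ∞) w) (x : Fin d → ℝ) :
    lap (fun y => v y - w y) x = lap v x - lap w x := by
  unfold lap
  rw [← Finset.sum_sub_distrib]
  refine Finset.sum_congr rfl fun i _ => ?_
  have : pder i (fun y => v y - w y) = fun y => pder i v y - pder i w y := by
    funext y; exact pder_sub hv hw i y
  rw [this, pder_sub (contDiff_pder hv i) (contDiff_pder hw i)]

lemma pder_const_mul (c : ℝ) (v : (Fin d → ℝ) → ℝ) (i : Fin d) :
    pder i (fun y => c * v y) = fun x => c * pder i v x := by
  funext x
  exact deriv_const_mul_field (v := fun s => v (Function.update x i s)) c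

lemma lap_const_mul (c : ℝ) (v : (Fin d → ℝ) → ℝ) :
    lap (fun y => c * v y) = fun x => c * lap v x := by
  funext x
  unfold lap
  rw [Finset.mul_sum]
  exact Finset.sum_congr rfl fun i _ => by rw [pder_const_mul, pder_const_mul]

namespace SmoothQ

variable {u v : (Fin d → ℝ) → ℝ → ℝ}

lemma cont (hu : SmoothQ u) : Continuous fun p : (Fin d → ℝ) × ℝ => u p.1 p.2 :=
  ContDiff.continuous hu

lemma space (hu : SmoothQ u) (t : ℝ) : ContDiff ℝ (⊤ : ℕ∞) fun x => u x t :=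
  ContDiff.comp (g := fun p : (Fin d → ℝ) × ℝ => u p.1 p.2) hu
    (contDiff_id.prodMk contDiff_const)

lemma time (hu : SmoothQ u) (x : Fin d → ℝ) : ContDiff ℝ (⊤ : ℕ∞) (u x) :=
  ContDiff.comp (g := fun p : (Fin d → ℝ) × ℝ => u p.1 p.2) hu
    (contDiff_const.prodMk contDiff_id)

lemma mul (hu : SmoothQ u) (hv : SmoothQ v) : SmoothQ fun x t => u x t * v x t :=
  ContDiff.mul hu hv

lemma add (hu : SmoothQ u) (hv : SmoothQ v) : SmoothQ fun x t => u x t + v x t :=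
  ContDiff.add hu hv

lemma sub (hu : SmoothQ u) (hv : SmoothQ v) : SmoothQ fun x t => u x t - v x t :=
  ContDiff.sub hu hv

lemma const_mul (c : ℝ) (hu : SmoothQ u) : SmoothQ fun x t => c * u x t :=
  contDiff_const.mul hu

lemma of_space {f : (Fin d → ℝ) → ℝ} (hf : ContDiff ℝ (⊤ : ℕ∞) f) : SmoothQ fun x _ => f x :=
  hf.comp contDiff_fst

lemma of_time {η : ℝ → ℝ} (hη : ContDiff ℝ (⊤ : ℕ∞) η) :
    SmoothQ fun (_ : Fin d → ℝ) t => η t :=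
  hη.comp contDiff_snd

lemma pder (hu : SmoothQ u) (i : Fin d) : SmoothQ fun x t => pder i (fun y => u y t) x := by
  have h1 : (fun p : (Fin d → ℝ) × ℝ => _root_.pder i (fun y => u y p.2) p.1) =
      fun p => fderiv ℝ (fun p : (Fin d → ℝ) × ℝ => u p.1 p.2) p (Pi.single i 1, 0) := by
    funext p
    have h2 : HasFDerivAt (fun y : Fin d → ℝ => (y, p.2))
        (ContinuousLinearMap.inl ℝ (Fin d → ℝ) ℝ) p.1 := hasFDerivAt_prodMk_left p.1 p.2
    have h3 : HasFDerivAt (fun p : (Fin d → ℝ) × ℝ => u p.1 p.2) _ (p.1, p.2) :=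
      (ContDiff.differentiable hu (by simp) p).hasFDerivAt
    have h4 : HasFDerivAt (fun y => u y p.2)
        ((fderiv ℝ (fun p : (Fin d → ℝ) × ℝ => u p.1 p.2) p).comp
          (ContinuousLinearMap.inl ℝ (Fin d → ℝ) ℝ)) p.1 :=
      HasFDerivAt.comp (g := fun p : (Fin d → ℝ) × ℝ => u p.1 p.2) p.1 h3 h2
    rw [pder_eq_fderiv h4.differentiableAt, h4.fderiv]
    simp
  unfold SmoothQ
  rw [h1]
  exact (ContDiff.fderiv_right (m := (⊤ : ℕ∞)) hu (by simp)).clm_apply contDiff_const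

lemma lap (hu : SmoothQ u) : SmoothQ fun x t => lap (fun y => u y t) x :=
  ContDiff.sum fun i _ => (hu.pder i).pder i

lemma deriv (hu : SmoothQ u) : SmoothQ fun x t => deriv (u x) t := by
  have h1 : (fun p : (Fin d → ℝ) × ℝ => _root_.deriv (u p.1) p.2) =
      fun p => fderiv ℝ (fun p : (Fin d → ℝ) × ℝ => u p.1 p.2) p (0, 1) := by
    funext p
    have h2 : HasDerivAt (fun s : ℝ => (p.1, s)) ((0 : Fin d → ℝ), (1 : ℝ)) p.2 :=
      (hasDerivAt_const _ _).prodMk (hasDerivAt_id _)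
    have h3 : HasFDerivAt (fun p : (Fin d → ℝ) × ℝ => u p.1 p.2) _ (p.1, p.2) :=
      (ContDiff.differentiable hu (by simp) p).hasFDerivAt
    exact (h3.comp_hasDerivAt _ h2).deriv
  unfold SmoothQ
  rw [h1]
  exact (ContDiff.fderiv_right (m := (⊤ : ℕ∞)) hu (by simp)).clm_apply contDiff_const

lemma hasDerivAt (hu : SmoothQ u) (x : Fin d → ℝ) (t : ℝ) :
    HasDerivAt (u x) (_root_.deriv (u x) t) t :=
  ((hu.time x).differentiable (by simp) t).hasDerivAt

end SmoothQ

namespace ZPerSpace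

variable {u v : (Fin d → ℝ) → ℝ → ℝ}

lemma mul (hu : ZPerSpace u) (hv : ZPerSpace v) : ZPerSpace fun x t => u x t * v x t :=
  fun t x k => congrArg₂ (· * ·) (hu t x k) (hv t x k)

lemma sub (hu : ZPerSpace u) (hv : ZPerSpace v) : ZPerSpace fun x t => u x t - v x t :=
  fun t x k => congrArg₂ (· - ·) (hu t x k) (hv t x k)

lemma add (hu : ZPerSpace u) (hv : ZPerSpace v) : ZPerSpace fun x t => u x t + v x t :=
  fun t x k => congrArg₂ (· + ·) (hu t x k) (hv t x k)

lemma const_mul (c : ℝ) (hu : ZPerSpace u) : ZPerSpace fun x t => c * u x t :=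
  fun t x k => congrArg (c * ·) (hu t x k)

lemma of_space {f : (Fin d → ℝ) → ℝ} (hf : ZPer f) : ZPerSpace fun x _ => f x :=
  fun _ => hf

lemma of_time (η : ℝ → ℝ) : ZPerSpace fun (_ : Fin d → ℝ) t => η t :=
  fun _ _ _ => rfl

lemma pder (hu : ZPerSpace u) (i : Fin d) : ZPerSpace fun x t => pder i (fun y => u y t) x :=
  fun t => (hu t).pder i

lemma lap (hu : ZPerSpace u) : ZPerSpace fun x t => lap (fun y => u y t) x :=
  fun t => (hu t).lap

lemma deriv (hu : ZPerSpace u) : ZPerSpace fun x t => deriv (u x) t := by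
  intro t x k
  have : u (fun i => x i + (k i : ℝ)) = u x := funext fun s => hu s x k
  simp only [this]

end ZPerSpace

end Calculus

section Integration

variable {d : ℕ}

lemma Continuous.integrableOn_unitCube {E : Type*} [NormedAddCommGroup E]
    {f : (Fin d → ℝ) → E} (hf : Continuous f) : IntegrableOn f (unitCube d) :=
  hf.continuousOn.integrableOn_compact isCompact_Icc

/-- The integral of a partial derivative of a periodic function over the torus vanishes. -/
lemma integral_pder_eq_zero {v : (Fin d → ℝ) → ℝ} (hv : ContDiff ℝ (⊤ : ℕ∞) v) (hper : ZPer v)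
    (i : Fin d) : ∫ x in unitCube d, pder i v x = 0 := by
  obtain ⟨n, rfl⟩ : ∃ n, d = n + 1 := ⟨d - 1, by have := i.pos; omega⟩
  have hdiff := hv.differentiable (by simp)
  have h := integral_divergence_of_hasFDerivAt_off_countable' (0 : Fin (n + 1) → ℝ) 1
    zero_le_one (fun j => if j = i then v else 0) (fun j => if j = i then fderiv ℝ v else 0)
    ∅ Set.countable_empty
    (fun j => by
      by_cases hj : j = i
      · simpa [hj] using hv.continuous.continuousOn
      · rw [if_neg hj]; exact continuousOn_const)
    (fun x _ j => by
      by_cases hj : j = i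
      · simpa [hj] using (hdiff x).hasFDerivAt
      · rw [if_neg hj, if_neg hj]; exact hasFDerivAt_const (0 : ℝ) x)
    (by
      refine ContinuousOn.integrableOn_compact isCompact_Icc (Continuous.continuousOn ?_)
      refine continuous_finsetSum _ fun j _ => ?_
      by_cases hj : j = i
      · simpa [hj] using (hv.continuous_fderiv (by simp)).clm_apply continuous_const
      · simpa [hj] using continuous_const)
  have h2 : ∀ x, ∑ j, (if j = i then fderiv ℝ v else 0) x (Pi.single j 1) = pder i v x := by
    intro x
    rw [Finset.sum_eq_single i]
    · rw [pder_eq_fderiv (hdiff x)]; simp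
    · intro j _ hj; simp [hj]
    · simp
  simp only [h2] at h
  rw [show unitCube (n + 1) = Set.Icc 0 1 from rfl, h]
  refine Finset.sum_eq_zero fun j _ => ?_
  by_cases hj : j = i
  · subst hj
    rw [sub_eq_zero]
    refine integral_congr_ae (Eventually.of_forall fun y => ?_)
    simp only [if_true]
    rw [← hper (Fin.insertNth j ((0 : Fin (n + 1) → ℝ) j) y) (Pi.single j 1)]
    congr 1
    funext k
    refine Fin.succAboveCases j ?_ (fun k => ?_) k
    · simp
    · simp
  · simp [hj]

/-- The product measure on the space-time cylinder. -/
noncomputable def volQ (d : ℕ) (T : ℝ) : Measure ((Fin d → ℝ) × ℝ) :=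
  (volume.restrict (unitCube d)).prod (volume.restrict (Set.Ioc (0 : ℝ) T))

lemma volQ_eq_restrict (T : ℝ) :
    volQ d T = (volume : Measure ((Fin d → ℝ) × ℝ)).restrict (unitCube d ×ˢ Set.Ioc 0 T) := by
  unfold volQ
  rw [Measure.prod_restrict]
  rfl

lemma integrable_volQ (T : ℝ) {K : (Fin d → ℝ) × ℝ → ℝ} (hK : Continuous K) :
    Integrable K (volQ d T) := by
  rw [volQ_eq_restrict]
  have h1 : IntegrableOn K (unitCube d ×ˢ Set.Icc 0 T) :=
    hK.continuousOn.integrableOn_compact (isCompact_Icc.prod isCompact_Icc)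
  exact h1.mono_set (Set.prod_mono le_rfl Set.Ioc_subset_Icc_self)

lemma ae_volQ (T : ℝ) : ∀ᵐ p ∂volQ d T, p.1 ∈ unitCube d ∧ p.2 ∈ Set.Ioc 0 T := by
  rw [volQ_eq_restrict]
  exact ae_restrict_mem (measurableSet_Icc.prod measurableSet_Ioc)

lemma integral_volQ {T : ℝ} {K : (Fin d → ℝ) → ℝ → ℝ}
    (hK : Continuous fun p : (Fin d → ℝ) × ℝ => K p.1 p.2) :
    ∫ p, K p.1 p.2 ∂volQ d T = ∫ x in unitCube d, ∫ t in Set.Ioc 0 T, K x t :=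
  integral_prod _ (integrable_volQ T hK)

lemma integral_volQ_symm {T : ℝ} {K : (Fin d → ℝ) → ℝ → ℝ}
    (hK : Continuous fun p : (Fin d → ℝ) × ℝ => K p.1 p.2) :
    ∫ p, K p.1 p.2 ∂volQ d T = ∫ t in Set.Ioc 0 T, ∫ x in unitCube d, K x t :=
  integral_prod_symm _ (integrable_volQ T hK)

lemma integral_volQ_deriv {T : ℝ} (hT : 0 ≤ T) {K : (Fin d → ℝ) → ℝ → ℝ} (hK : SmoothQ K)
    (h0 : ∀ x, K x 0 = 0) (h1 : ∀ x, K x T = 0) :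
    ∫ p, deriv (K p.1) p.2 ∂volQ d T = 0 := by
  rw [integral_volQ (K := fun x t => deriv (K x) t) hK.deriv.cont]
  refine integral_eq_zero_of_ae (Eventually.of_forall fun x => ?_)
  simp only [Pi.zero_apply]
  rw [← intervalIntegral.integral_of_le hT,
    intervalIntegral.integral_deriv_eq_sub
      (fun t _ => (hK.time x).differentiable (by simp) t)
      ((hK.deriv.time x).continuous.intervalIntegrable _ _), h0, h1, sub_zero]

lemma integral_volQ_pder {T : ℝ} {K : (Fin d → ℝ) → ℝ → ℝ} (hK : SmoothQ K)
    (hper : ZPerSpace K) (i : Fin d) :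
    ∫ p, pder i (fun y => K y p.2) p.1 ∂volQ d T = 0 := by
  rw [integral_volQ_symm (K := fun x t => pder i (fun y => K y t) x) (hK.pder i).cont]
  refine integral_eq_zero_of_ae (Eventually.of_forall fun t => ?_)
  exact integral_pder_eq_zero (hK.space t) (hper t) i

/-- The formal adjoint of the parabolic operator `∂_t - (θ/2)Δ + f`. -/
noncomputable def adjOp (θ : ℝ) (f : (Fin d → ℝ) → ℝ) (ψ : (Fin d → ℝ) → ℝ → ℝ) :
    (Fin d → ℝ) → ℝ → ℝ :=
  fun x t => f x * ψ x t - θ / 2 * lap (fun y => ψ y t) x - deriv (ψ x) t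

lemma continuous_adjOp {θ : ℝ} {f : (Fin d → ℝ) → ℝ} (hf : Continuous f)
    {ψ : (Fin d → ℝ) → ℝ → ℝ} (hψ : SmoothQ ψ) :
    Continuous fun p : (Fin d → ℝ) × ℝ => adjOp θ f ψ p.1 p.2 :=
  (((hf.comp continuous_fst).mul hψ.cont).sub (continuous_const.mul hψ.lap.cont)).sub
    hψ.deriv.cont

/-- Weak formulation of the inhomogeneous problem with zero initial value. -/
lemma integral_forcing_mul {T θ : ℝ} (hT : 0 ≤ T) {f : (Fin d → ℝ) → ℝ} (hf : Continuous f)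
    {w ψ g : (Fin d → ℝ) → ℝ → ℝ} (hw : SmoothQ w) (hwper : ZPerSpace w)
    (hψ : SmoothQ ψ) (hψper : ZPerSpace ψ)
    (hg : Continuous fun p : (Fin d → ℝ) × ℝ => g p.1 p.2)
    (heq : ∀ x, ∀ t ∈ Set.Ioc (0 : ℝ) T,
      deriv (w x) t = θ / 2 * lap (fun y => w y t) x - f x * w x t + g x t)
    (hw0 : ∀ x, w x 0 = 0) (hψT : ∀ x, ψ x T = 0) :
    ∫ p, g p.1 p.2 * ψ p.1 p.2 ∂volQ d T = ∫ p, w p.1 p.2 * adjOp θ f ψ p.1 p.2 ∂volQ d T := by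
  have hI1 := integrable_volQ T (hg.fun_mul hψ.cont)
  have hI2 := integrable_volQ T (hw.cont.fun_mul (continuous_adjOp (θ := θ) hf hψ))
  rw [← sub_eq_zero, ← integral_sub hI1 hI2]
  let J : Fin d → (Fin d → ℝ) → ℝ → ℝ := fun i x t =>
    pder i (fun y => w y t) x * ψ x t - w x t * pder i (fun y => ψ y t) x
  have hJ : ∀ i, SmoothQ (J i) := fun i => ((hw.pder i).mul hψ).sub (hw.mul (hψ.pder i))
  have hJper : ∀ i, ZPerSpace (J i) := fun i =>
    ((hwper.pder i).mul hψper).sub (hwper.mul (hψper.pder i))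
  have hJd : ∀ (i : Fin d) (x : Fin d → ℝ) (t : ℝ), pder i (fun y => J i y t) x =
      pder i (pder i fun y => w y t) x * ψ x t - w x t * pder i (pder i fun y => ψ y t) x := by
    intro i x t
    have a1 := contDiff_pder (hw.space t) i
    have a2 := contDiff_pder (hψ.space t) i
    rw [show (fun y => J i y t) = fun y => pder i (fun y => w y t) y * ψ y t
      - w y t * pder i (fun y => ψ y t) y from rfl,
      pder_sub (a1.mul (hψ.space t)) ((hw.space t).mul a2), pder_mul a1 (hψ.space t),
      pder_mul (hw.space t) a2]
    ring
  have hK := hw.mul hψ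
  have hkey : ∀ᵐ p ∂volQ d T, g p.1 p.2 * ψ p.1 p.2 - w p.1 p.2 * adjOp θ f ψ p.1 p.2 =
      deriv (fun t => w p.1 t * ψ p.1 t) p.2
        - θ / 2 * ∑ i, pder i (fun y => J i y p.2) p.1 := by
    filter_upwards [ae_volQ T] with p hp
    have e1 := heq p.1 p.2 hp.2
    have e2 : deriv (fun t => w p.1 t * ψ p.1 t) p.2 =
        deriv (w p.1) p.2 * ψ p.1 p.2 + w p.1 p.2 * deriv (ψ p.1) p.2 :=
      ((hw.hasDerivAt p.1 p.2).mul (hψ.hasDerivAt p.1 p.2)).deriv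
    have e3 : ∑ i, pder i (fun y => J i y p.2) p.1 =
        lap (fun y => w y p.2) p.1 * ψ p.1 p.2 - w p.1 p.2 * lap (fun y => ψ y p.2) p.1 := by
      simp only [hJd, Finset.sum_sub_distrib, lap, Finset.sum_mul, Finset.mul_sum]
    rw [e2, e3, e1, adjOp]
    ring
  rw [integral_congr_ae hkey, integral_sub, integral_const_mul, integral_finsetSum,
    integral_volQ_deriv hT hK (by simp [hw0]) (by simp [hψT])]
  · simp [integral_volQ_pder (hJ _) (hJper _)]
  · exact fun i _ => integrable_volQ T ((hJ i).pder i).cont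
  · exact integrable_volQ T hK.deriv.cont
  · exact (integrable_finsetSum _ fun i _ => integrable_volQ T ((hJ i).pder i).cont).const_mul _

/-- Cauchy–Schwarz inequality for integrals of real functions. -/
lemma abs_integral_mul_le {α : Type*} [MeasurableSpace α] {μ : Measure α} {f g : α → ℝ}
    (hf : Integrable (fun x => f x ^ 2) μ) (hg : Integrable (fun x => g x ^ 2) μ)
    (hfg : Integrable (fun x => f x * g x) μ) :
    |∫ x, f x * g x ∂μ| ≤ √(∫ x, f x ^ 2 ∂μ) * √(∫ x, g x ^ 2 ∂μ) := by
  set A := ∫ x, f x ^ 2 ∂μ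
  set B := ∫ x, f x * g x ∂μ
  set C := ∫ x, g x ^ 2 ∂μ
  have hA : 0 ≤ A := integral_nonneg fun x => sq_nonneg _
  have hC : 0 ≤ C := integral_nonneg fun x => sq_nonneg _
  have h : ∀ s : ℝ, 0 ≤ A * (s * s) + (2 * B) * s + C := by
    intro s
    have : ∫ x, (s * f x + g x) ^ 2 ∂μ = A * (s * s) + (2 * B) * s + C := by
      have e : (fun x => (s * f x + g x) ^ 2) =
          fun x => (s * s) * f x ^ 2 + (2 * s) * (f x * g x) + g x ^ 2 := by
        funext x; ring
      rw [e, integral_add ((hf.const_mul _).fun_add (hfg.const_mul _)) hg,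
        integral_add (hf.const_mul _) (hfg.const_mul _), integral_const_mul, integral_const_mul]
      ring
    rw [← this]
    exact integral_nonneg fun x => sq_nonneg _
  have hd := discrim_le_zero h
  rw [discrim] at hd
  rw [← Real.sqrt_mul hA]
  exact Real.abs_le_sqrt (by nlinarith)

end Integration

section Eigenfunction

variable {d : ℕ}

lemma eq_of_hasDerivAt_eq_zero_Ioo {T : ℝ} {g g' : ℝ → ℝ} (hg : ContinuousOn g (Set.Icc 0 T))
    (hd : ∀ t ∈ Set.Ioo 0 T, HasDerivAt g (g' t) t) (h0 : ∀ t ∈ Set.Ioo 0 T, g' t = 0) :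
    ∀ t ∈ Set.Icc 0 T, g t = g 0 := by
  intro t ht
  rcases ht.1.eq_or_lt with h | h
  · rw [← h]
  · obtain ⟨c, hc, hc'⟩ := exists_hasDerivAt_eq_slope g g' h
      (hg.mono (Set.Icc_subset_Icc_right ht.2)) (fun s hs => hd s ⟨hs.1, hs.2.trans_le ht.2⟩)
    rw [h0 c ⟨hc.1, hc.2.trans_le ht.2⟩, eq_comm, div_eq_zero_iff] at hc'
    rcases hc' with h' | h' <;> linarith

lemma pder_add {v w : (Fin d → ℝ) → ℝ} (hv : ContDiff ℝ (⊤ : ℕ∞) v)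
    (hw : ContDiff ℝ (⊤ : ℕ∞) w) (i : Fin d) (x : Fin d → ℝ) :
    pder i (fun y => v y + w y) x = pder i v x + pder i w x := by
  have hv' := hv.differentiable (by simp) x
  have hw' := hw.differentiable (by simp) x
  rw [pder_eq_fderiv (hv'.fun_add hw'), pder_eq_fderiv hv', pder_eq_fderiv hw',
    fderiv_fun_add hv' hw']
  simp

lemma pder_exp {b : (Fin d → ℝ) → ℝ} (hb : ContDiff ℝ (⊤ : ℕ∞) b) (i : Fin d)
    (x : Fin d → ℝ) :
    pder i (fun y => exp (b y)) x = exp (b x) * pder i b x := by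
  have hb' := hb.differentiable (by simp) x
  rw [pder_eq_fderiv hb'.exp, pder_eq_fderiv hb', fderiv_exp hb']
  simp

lemma pder_pder_mul_exp {U b : (Fin d → ℝ) → ℝ} (hU : ContDiff ℝ (⊤ : ℕ∞) U)
    (hb : ContDiff ℝ (⊤ : ℕ∞) b) (t : ℝ) (i : Fin d) (x : Fin d → ℝ) :
    pder i (pder i fun y => U y * exp (t * b y)) x = exp (t * b x) *
      (pder i (pder i U) x + t * (2 * pder i U x * pder i b x + U x * pder i (pder i b) x)
        + t ^ 2 * (U x * pder i b x ^ 2)) := by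
  have htb : ContDiff ℝ (⊤ : ℕ∞) fun y => t * b y := contDiff_const.mul hb
  have hE : ContDiff ℝ (⊤ : ℕ∞) fun y => exp (t * b y) := htb.exp
  have key : ∀ G : (Fin d → ℝ) → ℝ, ContDiff ℝ (⊤ : ℕ∞) G →
      pder i (fun y => G y * exp (t * b y)) =
        fun y => (pder i G y + t * (G y * pder i b y)) * exp (t * b y) := by
    intro G hG
    funext y
    rw [pder_mul hG hE, pder_exp htb, pder_const_mul]
    ring
  have hUi := contDiff_pder hU i
  have hbi := contDiff_pder hb i
  have hUb : ContDiff ℝ (⊤ : ℕ∞) fun y => U y * pder i b y := hU.mul hbi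
  have htUb : ContDiff ℝ (⊤ : ℕ∞) fun y => t * (U y * pder i b y) := contDiff_const.mul hUb
  rw [key U hU, key _ (hUi.add htUb)]
  simp only
  rw [pder_add hUi htUb, pder_const_mul]
  simp only [pder_mul hU hbi]
  ring

lemma lap_mul_exp {U b : (Fin d → ℝ) → ℝ} (hU : ContDiff ℝ (⊤ : ℕ∞) U)
    (hb : ContDiff ℝ (⊤ : ℕ∞) b) (t : ℝ) (x : Fin d → ℝ) :
    lap (fun y => U y * exp (t * b y)) x = exp (t * b x) *
      (lap U x + t * (∑ i, (2 * pder i U x * pder i b x + U x * pder i (pder i b) x))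
        + t ^ 2 * (U x * ∑ i, pder i b x ^ 2)) := by
  unfold lap
  simp only [pder_pder_mul_exp hU hb]
  rw [← Finset.mul_sum, Finset.sum_add_distrib, Finset.sum_add_distrib, ← Finset.mul_sum,
    ← Finset.mul_sum, ← Finset.mul_sum]

lemma eq_const_of_pder_eq_zero {b : (Fin d → ℝ) → ℝ} (hb : ContDiff ℝ (⊤ : ℕ∞) b)
    (h : ∀ i x, pder i b x = 0) (x : Fin d → ℝ) : b x = b 0 := by
  refine is_const_of_fderiv_eq_zero (𝕜 := ℝ) (hb.differentiable (by simp)) (fun y => ?_) x 0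
  refine ContinuousLinearMap.coe_injective (LinearMap.pi_ext' fun i => LinearMap.ext_ring ?_)
  have := h i y
  rw [pder_eq_fderiv (hb.differentiable (by simp) y)] at this
  simpa using this

/-- The obstruction to `Δu / u` being independent of time. -/
noncomputable def lapWronskian (u : (Fin d → ℝ) → ℝ → ℝ) (x : Fin d → ℝ) (t : ℝ) : ℝ :=
  u x t * deriv (fun s => lap (fun y => u y s) x) t - lap (fun y => u y t) x * deriv (u x) t

lemma smoothQ_lapWronskian {u : (Fin d → ℝ) → ℝ → ℝ} (hu : SmoothQ u) :
    SmoothQ (lapWronskian u) :=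
  (hu.mul hu.lap.deriv).sub (hu.lap.mul hu.deriv)

lemma zPerSpace_lapWronskian {u : (Fin d → ℝ) → ℝ → ℝ} (hu : ZPerSpace u) :
    ZPerSpace (lapWronskian u) :=
  (hu.mul hu.lap.deriv).sub (hu.lap.mul hu.deriv)

/-- If `Δu / u` is constant in time for a positive solution of the heat equation with absorption,
then its initial value is an eigenfunction of the Schrödinger operator. -/
lemma eigenfunction_of_lapWronskian_eq_zero {T θ : ℝ} (hT : 0 < T) (hθ : 0 < θ)
    {f u0 : (Fin d → ℝ) → ℝ} (hu0 : ContDiff ℝ (⊤ : ℕ∞) u0) (hu0pos : ∀ x, 0 < u0 x)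
    {u : (Fin d → ℝ) → ℝ → ℝ} (hu : HeatSol T θ f u0 u)
    (hpos : ∀ x, ∀ t ∈ Set.Icc 0 T, 0 < u x t)
    (hW : ∀ x, ∀ t ∈ Set.Ioo 0 T, lapWronskian u x t = 0) :
    ∃ lam : ℝ, ∀ x, θ / 2 * lap u0 x - f x * u0 x = lam * u0 x := by
  obtain ⟨hs, -, hpde, hinit⟩ := hu
  set b : (Fin d → ℝ) → ℝ := fun x => deriv (u x) 0 / u0 x with hbdef
  have hb : ContDiff ℝ (⊤ : ℕ∞) b := (hs.deriv.space 0).div hu0 fun x => (hu0pos x).ne'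
  have hlap : ∀ x, ∀ t ∈ Set.Ioo 0 T,
      lap (fun y => u y t) x = 2 / θ * (deriv (u x) t + f x * u x t) := by
    intro x t ht
    rw [hpde x t ⟨ht.1, ht.2.le⟩]
    field_simp
    ring
  have hODE : ∀ x, ∀ t ∈ Set.Ioo 0 T,
      u x t * deriv (deriv (u x)) t = deriv (u x) t ^ 2 := by
    intro x t ht
    have h1 : (fun s => lap (fun y => u y s) x) =ᶠ[nhds t]
        fun s => 2 / θ * (deriv (u x) s + f x * u x s) := by
      filter_upwards [Ioo_mem_nhds ht.1 ht.2] with s hs using hlap x s hs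
    have h2 : deriv (fun s => lap (fun y => u y s) x) t =
        2 / θ * (deriv (deriv (u x)) t + f x * deriv (u x) t) := by
      rw [h1.deriv_eq]
      exact (((hs.deriv.hasDerivAt x t).add ((hs.hasDerivAt x t).const_mul _)).const_mul _).deriv
    have h3 := hW x t ht
    rw [lapWronskian, h2, hlap x t ht] at h3
    have h4 : 2 / θ * (u x t * deriv (deriv (u x)) t - deriv (u x) t ^ 2) = 0 := by
      linear_combination h3
    have h5 : 2 / θ ≠ 0 := by positivity
    have := (mul_eq_zero.1 h4).resolve_left h5
    linarith
  have hquot : ∀ x, ∀ t ∈ Set.Icc 0 T, deriv (u x) t / u x t = b x := by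
    intro x t ht
    have := eq_of_hasDerivAt_eq_zero_Ioo (T := T) (g := fun t => deriv (u x) t / u x t)
      (g' := fun t => (deriv (deriv (u x)) t * u x t - deriv (u x) t * deriv (u x) t) / u x t ^ 2)
      ((hs.deriv.time x).continuous.continuousOn.div (hs.time x).continuous.continuousOn
        fun s hs => (hpos x s hs).ne')
      (fun s hs' => (hs.deriv.hasDerivAt x s).div (hs.hasDerivAt x s)
        (hpos x s (Set.Ioo_subset_Icc_self hs')).ne')
      (fun s hs' => by
        have := hODE x s hs'
        rw [show deriv (deriv (u x)) s * u x s - deriv (u x) s * deriv (u x) s = 0 by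
          linear_combination this, zero_div])
      t ht
    rw [this, hbdef, hinit]
  have hexp : ∀ x, ∀ t ∈ Set.Icc 0 T, u x t = u0 x * exp (t * b x) := by
    intro x t ht
    have := eq_of_hasDerivAt_eq_zero_Ioo (T := T) (g := fun t => u x t * exp (-(t * b x)))
      (g' := fun t => deriv (u x) t * exp (-(t * b x)) + u x t * (exp (-(t * b x)) * -(1 * b x)))
      (by
        have := (hs.time x).continuous
        fun_prop)
      (fun s _ => (hs.hasDerivAt x s).mul ((((hasDerivAt_id s).mul_const (b x)).neg).exp))
      (fun s hs' => by
        have h1 := hquot x s (Set.Ioo_subset_Icc_self hs')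
        rw [div_eq_iff (hpos x s (Set.Ioo_subset_Icc_self hs')).ne'] at h1
        rw [h1]; ring)
      t ht
    simp only [zero_mul, neg_zero, exp_zero, mul_one, hinit, exp_neg] at this
    rw [← this]
    field_simp
  have hpoly : ∀ x, ∀ t ∈ Set.Ioo 0 T, (b x + f x) * u0 x = θ / 2 *
      (lap u0 x + t * (∑ i, (2 * pder i u0 x * pder i b x + u0 x * pder i (pder i b) x))
        + t ^ 2 * (u0 x * ∑ i, pder i b x ^ 2)) := by
    intro x t ht
    have ht' := Set.Ioo_subset_Icc_self ht
    have h1 : (fun y => u y t) = fun y => u0 y * exp (t * b y) := funext fun y => hexp y t ht'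
    have h2 := hpde x t ⟨ht.1, ht.2.le⟩
    have h3 := hquot x t ht'
    rw [div_eq_iff (hpos x t ht').ne'] at h3
    rw [h1, lap_mul_exp hu0 hb, h3, hexp x t ht'] at h2
    have h4 : exp (t * b x) ≠ 0 := (exp_pos _).ne'
    apply mul_left_cancel₀ h4
    linear_combination h2
  have hcoef : ∀ x, (∑ i, pder i b x ^ 2 = 0) ∧ (b x + f x) * u0 x = θ / 2 * lap u0 x := by
    intro x
    have e1 := hpoly x (T / 4) ⟨by positivity, by linarith⟩
    have e2 := hpoly x (T / 2) ⟨by positivity, by linarith⟩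
    have e3 := hpoly x (3 * T / 4) ⟨by positivity, by linarith⟩
    set S := ∑ i, pder i b x ^ 2
    set B := ∑ i, (2 * pder i u0 x * pder i b x + u0 x * pder i (pder i b) x)
    have hC : (θ * T ^ 2 * u0 x) * S = 0 := by linear_combination 16 * (2 * e2 - e1 - e3)
    have hpos' : θ * T ^ 2 * u0 x ≠ 0 := by have := hu0pos x; positivity
    have hS := (mul_eq_zero.1 hC).resolve_left hpos'
    refine ⟨hS, ?_⟩
    rw [hS] at e1 e2
    linear_combination 2 * e1 - e2
  have hconst : ∀ x, b x = b 0 := by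
    refine eq_const_of_pder_eq_zero hb fun i x => ?_
    have := (Finset.sum_eq_zero_iff_of_nonneg fun j _ => sq_nonneg (pder j b x)).1 (hcoef x).1 i
      (Finset.mem_univ i)
    exact pow_eq_zero_iff two_ne_zero |>.1 this
  refine ⟨b 0, fun x => ?_⟩
  have := (hcoef x).2
  rw [hconst x] at this
  linear_combination -this

end Eigenfunction

noncomputable section Fourier

local instance : MeasureSpace UnitAddCircle := ⟨AddCircle.haarAddCircle⟩

local instance : Measure.IsAddHaarMeasure (volume : Measure UnitAddCircle) :=
  inferInstanceAs (Measure.IsAddHaarMeasure AddCircle.haarAddCircle)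

local instance : IsProbabilityMeasure (volume : Measure UnitAddCircle) :=
  inferInstanceAs (IsProbabilityMeasure AddCircle.haarAddCircle)

open UnitAddTorus

variable {d : ℕ}

/-- The point of the torus `(ℝ/ℤ)^d` represented by `x`. -/
def toTorus (x : Fin d → ℝ) : UnitAddTorus (Fin d) := fun i => (x i : UnitAddCircle)

lemma integral_torus {E : Type*} [NormedAddCommGroup E] [NormedSpace ℝ E]
    (f : UnitAddTorus (Fin d) → E) : ∫ t, f t = ∫ x in unitCube d, f (toTorus x) := by
  rw [UnitAddTorus.integral_preimage _ 0]
  refine setIntegral_congr_set ?_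
  have := Measure.univ_pi_Ioc_ae_eq_Icc (μ := fun _ : Fin d => (volume : Measure ℝ))
    (f := 0) (g := 1)
  have h : {x : Fin d → ℝ | ∀ i, x i ∈ Set.Ioc ((0 : Fin d → ℝ) i) ((0 : Fin d → ℝ) i + 1)} =
      Set.univ.pi fun i => Set.Ioc ((0 : Fin d → ℝ) i) ((1 : Fin d → ℝ) i) := by
    ext x; simp
  rw [h]
  exact this

lemma hasSum_norm_sq_mFourierCoeff (f : C(UnitAddTorus (Fin d), ℂ)) :
    HasSum (fun k ↦ ‖mFourierCoeff f k‖ ^ 2) (∫ x in unitCube d, ‖f (toTorus x)‖ ^ 2) := by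
  have h := hasSum_sq_mFourierCoeff (ContinuousMap.toLp 2 _ ℂ f)
  simp only [mFourierCoeff_toLp] at h
  convert h using 1
  rw [← integral_torus (fun t => ‖f t‖ ^ 2)]
  refine integral_congr_ae ?_
  filter_upwards [ContinuousMap.coeFn_toLp (p := 2) (𝕜 := ℂ) volume f] with t ht
  rw [ht]

lemma mFourierCoeff_sub_sum (f : C(UnitAddTorus (Fin d), ℂ)) (S : Finset (Fin d → ℤ))
    (a : (Fin d → ℤ) → ℂ) (k : Fin d → ℤ) :
    mFourierCoeff (f - ∑ j ∈ S, a j • mFourier j : C(UnitAddTorus (Fin d), ℂ)) k =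
      mFourierCoeff f k - if k ∈ S then a k else 0 := by
  classical
  rw [← mFourierCoeff_toLp, ← mFourierCoeff_toLp, ← mFourierBasis_repr, ← mFourierBasis_repr]
  simp only [map_sub, map_sum, map_smul]
  have h (j : Fin d → ℤ) : ContinuousMap.toLp (E := ℂ) 2 volume ℂ (mFourier j) =
      mFourierBasis (d := Fin d) j := by simp
  simp only [h, HilbertBasis.repr_self]
  simp only [lp.coeFn_sub, lp.coeFn_sum, lp.coeFn_smul, Pi.sub_apply, Finset.sum_apply,
    Pi.smul_apply, lp.single_apply, smul_eq_mul, Pi.single_apply]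
  simp

lemma exists_continuousMap_torus {v : (Fin d → ℝ) → ℝ} (hv : Continuous v) (hper : ZPer v) :
    ∃ f : C(UnitAddTorus (Fin d), ℂ), ∀ x, f (toTorus x) = v x := by
  have hq : Topology.IsQuotientMap (toTorus : (Fin d → ℝ) → UnitAddTorus (Fin d)) :=
    (IsOpenQuotientMap.piMap fun _ : Fin d =>
      QuotientAddGroup.isOpenQuotientMap_mk).isQuotientMap
  have hq' : Topology.IsQuotientMap (⟨toTorus, hq.continuous⟩ :
      C(Fin d → ℝ, UnitAddTorus (Fin d))) := hq
  let g : C(Fin d → ℝ, ℂ) := ⟨fun x => (v x : ℂ), by fun_prop⟩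
  have hfac : Function.FactorsThrough g (⟨toTorus, hq.continuous⟩ :
      C(Fin d → ℝ, UnitAddTorus (Fin d))) := by
    intro x y hxy
    have h (i : Fin d) : ∃ n : ℤ, x i + n = y i := by
      have := congrFun hxy i
      have h0 : ((y i - x i : ℝ) : UnitAddCircle) = 0 := by
        rw [AddCircle.coe_sub]; simpa [sub_eq_zero, toTorus] using this.symm
      obtain ⟨n, hn⟩ := (AddCircle.coe_eq_zero_iff 1).1 h0
      exact ⟨n, by simp at hn; linarith⟩
    choose n hn using h
    have := hper x n
    simp only [hn] at this
    simpa [g] using this.symm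
  exact ⟨hq'.lift g hfac, fun x => congrArg (fun h => h x) (hq'.lift_comp g hfac)⟩

/-- The phase `2π k·x`. -/
def phase (k : Fin d → ℤ) (x : Fin d → ℝ) : ℝ := 2 * π * ∑ i, k i * x i

lemma contDiff_phase (k : Fin d → ℤ) : ContDiff ℝ (⊤ : ℕ∞) (phase k) := by
  unfold phase; fun_prop

lemma phase_add_int (k n : Fin d → ℤ) (x : Fin d → ℝ) :
    phase k (fun i => x i + n i) = phase k x + (∑ i, k i * n i : ℤ) * (2 * π) := by
  simp only [phase, mul_add, Finset.sum_add_distrib]; push_cast; ring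

lemma mFourier_toTorus (k : Fin d → ℤ) (x : Fin d → ℝ) :
    mFourier k (toTorus x) = Complex.exp (phase k x * Complex.I) := by
  simp only [mFourier, toTorus, ContinuousMap.coe_mk, fourier_coe_apply, phase]
  rw [← Complex.exp_sum]
  congr 1
  push_cast
  rw [Finset.mul_sum, Finset.sum_mul]
  exact Finset.sum_congr rfl fun i _ => by simp; ring

/-- The Fourier cosine coefficient of `v`. -/
def cosCoeff (v : (Fin d → ℝ) → ℝ) (k : Fin d → ℤ) : ℝ :=
  ∫ x in unitCube d, v x * cos (phase k x)

/-- The Fourier sine coefficient of `v`. -/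
def sinCoeff (v : (Fin d → ℝ) → ℝ) (k : Fin d → ℤ) : ℝ :=
  ∫ x in unitCube d, v x * sin (phase k x)

lemma mFourierCoeff_eq {v : (Fin d → ℝ) → ℝ} (hv : Continuous v)
    {f : C(UnitAddTorus (Fin d), ℂ)} (hf : ∀ x, f (toTorus x) = v x) (k : Fin d → ℤ) :
    mFourierCoeff f k = ⟨cosCoeff v k, - sinCoeff v k⟩ := by
  have hphase := (contDiff_phase k).continuous
  have hc : Continuous fun x => v x * cos (phase k x) := by fun_prop
  have hs : Continuous fun x => v x * sin (phase k x) := by fun_prop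
  have h1 : mFourierCoeff f k = ∫ x in unitCube d,
      (((v x * cos (phase k x) : ℝ) : ℂ) - ((v x * sin (phase k x) : ℝ) : ℂ) * Complex.I) := by
    rw [mFourierCoeff, integral_torus]
    refine integral_congr_ae (Eventually.of_forall fun x => ?_)
    simp only [smul_eq_mul, hf, mFourier_neg, mFourier_toTorus]
    rw [Complex.exp_ofReal_mul_I, map_add, map_mul, Complex.conj_ofReal, Complex.conj_ofReal,
      Complex.conj_I]
    push_cast
    ring
  rw [h1, integral_sub, integral_mul_const, integral_complex_ofReal, integral_complex_ofReal]
  · apply Complex.ext <;> simp [cosCoeff, sinCoeff]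
  · exact (Continuous.integrableOn_unitCube hc).ofReal
  · exact (Continuous.integrableOn_unitCube hs).ofReal.mul_const _

/-- The squared modulus of the Fourier coefficient of `v`. -/
def coeffSq (v : (Fin d → ℝ) → ℝ) (k : Fin d → ℤ) : ℝ := cosCoeff v k ^ 2 + sinCoeff v k ^ 2

lemma norm_mFourierCoeff_sq {v : (Fin d → ℝ) → ℝ} (hv : Continuous v)
    {f : C(UnitAddTorus (Fin d), ℂ)} (hf : ∀ x, f (toTorus x) = v x) (k : Fin d → ℤ) :
    ‖mFourierCoeff f k‖ ^ 2 = coeffSq v k := by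
  rw [mFourierCoeff_eq hv hf, ← Complex.normSq_eq_norm_sq, Complex.normSq_mk, coeffSq]; ring

lemma hasSum_coeffSq {v : (Fin d → ℝ) → ℝ} (hv : Continuous v) (hper : ZPer v) :
    HasSum (coeffSq v) (∫ x in unitCube d, v x ^ 2) := by
  obtain ⟨f, hf⟩ := exists_continuousMap_torus hv hper
  have h := hasSum_norm_sq_mFourierCoeff f
  simp only [norm_mFourierCoeff_sq hv hf, hf] at h
  simpa using h

lemma pder_comp_phase {g g' : ℝ → ℝ} (hg : ∀ y, HasDerivAt g (g' y) y) (k : Fin d → ℤ)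
    (i : Fin d) (x : Fin d → ℝ) :
    pder i (fun y => g (phase k y)) x = 2 * π * k i * g' (phase k x) := by
  have h : HasDerivAt (fun s => phase k (Function.update x i s)) (2 * π * k i) (x i) := by
    have : (fun s => phase k (Function.update x i s)) =
        fun s => 2 * π * k i * s + 2 * π * ∑ j ∈ Finset.univ.erase i, k j * x j := by
      funext s
      rw [phase, ← Finset.add_sum_erase _ _ (Finset.mem_univ i), Function.update_self, mul_add,
        ← mul_assoc]
      congr 2
      exact Finset.sum_congr rfl fun j hj => by
        rw [Function.update_of_ne (Finset.ne_of_mem_erase hj)]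
    rw [this]
    simpa using ((hasDerivAt_id (x i)).const_mul (2 * π * (k i : ℝ))).add_const
      (2 * π * ∑ j ∈ Finset.univ.erase i, (k j : ℝ) * x j)
  have h2 := (hg (phase k (Function.update x i (x i)))).comp (x i) h
  rw [Function.update_eq_self] at h2
  rw [pder]
  exact h2.deriv.trans (mul_comm _ _)

lemma zPer_cos_phase (k : Fin d → ℤ) : ZPer fun x => cos (phase k x) := fun x n => by
  simp only [phase_add_int, cos_add_int_mul_two_pi]

lemma zPer_sin_phase (k : Fin d → ℤ) : ZPer fun x => sin (phase k x) := fun x n => by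
  simp only [phase_add_int, sin_add_int_mul_two_pi]

lemma integral_pder_mul {v w : (Fin d → ℝ) → ℝ} (hv : ContDiff ℝ (⊤ : ℕ∞) v) (hvper : ZPer v)
    (hw : ContDiff ℝ (⊤ : ℕ∞) w) (hwper : ZPer w) (i : Fin d) :
    ∫ x in unitCube d, pder i v x * w x = - ∫ x in unitCube d, v x * pder i w x := by
  have h := integral_pder_eq_zero (hv.mul hw) (fun x n => by
    change v _ * w _ = v _ * w _
    rw [hvper, hwper]) i
  have h2 : ∀ x, pder i (v * w) x = pder i v x * w x + v x * pder i w x := fun x =>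
    (pder_mul hv hw i x).trans (by ring)
  have h3 := (contDiff_pder hv i).continuous
  have h4 := (contDiff_pder hw i).continuous
  change ∫ x in unitCube d, pder i (v * w) x = 0 at h
  simp only [h2] at h
  rw [integral_add (Continuous.integrableOn_unitCube (h3.fun_mul hw.continuous))
    (Continuous.integrableOn_unitCube (hv.continuous.fun_mul h4))] at h
  linarith

lemma coeffSq_pder {v : (Fin d → ℝ) → ℝ} (hv : ContDiff ℝ (⊤ : ℕ∞) v) (hper : ZPer v)
    (i : Fin d) (k : Fin d → ℤ) :
    coeffSq (pder i v) k = (2 * π * k i) ^ 2 * coeffSq v k := by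
  have hc : cosCoeff (pder i v) k = 2 * π * k i * sinCoeff v k := by
    rw [cosCoeff, integral_pder_mul (w := fun x => cos (phase k x)) hv hper
      (contDiff_cos.comp (contDiff_phase k))
      (zPer_cos_phase k), sinCoeff, ← integral_const_mul, ← integral_neg]
    refine integral_congr_ae (Eventually.of_forall fun x => ?_)
    change -(v x * pder i (fun y => cos (phase k y)) x) = _
    rw [pder_comp_phase hasDerivAt_cos]; ring
  have hs : sinCoeff (pder i v) k = - (2 * π * k i * cosCoeff v k) := by
    rw [sinCoeff, integral_pder_mul (w := fun x => sin (phase k x)) hv hper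
      (contDiff_sin.comp (contDiff_phase k))
      (zPer_sin_phase k), cosCoeff, ← integral_const_mul]
    congr 1
    refine integral_congr_ae (Eventually.of_forall fun x => ?_)
    change (v x * pder i (fun y => sin (phase k y)) x) = _
    rw [pder_comp_phase hasDerivAt_sin]; ring
  rw [coeffSq, hc, hs, coeffSq]; ring

lemma contDiff_iterate_pder {v : (Fin d → ℝ) → ℝ} (hv : ContDiff ℝ (⊤ : ℕ∞) v) (i : Fin d)
    (n : ℕ) : ContDiff ℝ (⊤ : ℕ∞) ((pder i)^[n] v) := by
  induction n with
  | zero => exact hv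
  | succ n ih => rw [Function.iterate_succ_apply']; exact contDiff_pder ih i

lemma ZPer.iterate_pder {v : (Fin d → ℝ) → ℝ} (hv : ZPer v) (i : Fin d) (n : ℕ) :
    ZPer ((_root_.pder i)^[n] v) := by
  induction n with
  | zero => exact hv
  | succ n ih => rw [Function.iterate_succ_apply']; exact ih.pder i

lemma coeffSq_iterate_pder {v : (Fin d → ℝ) → ℝ} (hv : ContDiff ℝ (⊤ : ℕ∞) v) (hper : ZPer v)
    (i : Fin d) (n : ℕ) (k : Fin d → ℤ) :
    coeffSq ((pder i)^[n] v) k = (2 * π * k i) ^ (2 * n) * coeffSq v k := by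
  induction n with
  | zero => simp
  | succ n ih =>
    rw [Function.iterate_succ_apply', coeffSq_pder (contDiff_iterate_pder hv i n)
      (hper.iterate_pder i n), ih]
    ring

lemma coeffSq_nonneg (v : (Fin d → ℝ) → ℝ) (k : Fin d → ℤ) : 0 ≤ coeffSq v k := by
  unfold coeffSq; positivity

/-- The `L²` part of top order `β` of the Sobolev norm, in pure derivatives. -/
def topSq (β : ℕ) (v : (Fin d → ℝ) → ℝ) : ℝ :=
  ∑ i : Fin d, ∫ x in unitCube d, ((pder i)^[β] v x) ^ 2

lemma hasSum_topSq {v : (Fin d → ℝ) → ℝ} (hv : ContDiff ℝ (⊤ : ℕ∞) v) (hper : ZPer v) (β : ℕ) :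
    HasSum (fun k => (∑ i, (2 * π * k i) ^ (2 * β)) * coeffSq v k) (topSq β v) := by
  have h := hasSum_sum fun i (_ : i ∈ Finset.univ) =>
    hasSum_coeffSq (contDiff_iterate_pder hv i β).continuous (hper.iterate_pder i β)
  simp only [coeffSq_iterate_pder hv hper] at h
  simpa only [Finset.sum_mul, topSq] using h

lemma norm_pow_le_sum (k : Fin d → ℤ) {n : ℕ} (hn : 1 ≤ n) :
    ‖fun i => (k i : ℝ)‖ ^ (2 * n) ≤ ∑ i, (k i : ℝ) ^ (2 * n) := by
  have hnn : ∀ i ∈ Finset.univ, 0 ≤ (k i : ℝ) ^ (2 * n) := fun i _ => (even_two_mul n).pow_nonneg _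
  rcases isEmpty_or_nonempty (Fin d) with h | h
  · have : (fun i => (k i : ℝ)) = 0 := Subsingleton.elim _ _
    rw [this, norm_zero, zero_pow (by omega)]
    exact Finset.sum_nonneg hnn
  · obtain ⟨i, hi⟩ := Finite.exists_max fun i => ‖(k i : ℝ)‖
    have h : ‖fun i => (k i : ℝ)‖ ≤ ‖(k i : ℝ)‖ := (pi_norm_le_iff_of_nonneg (norm_nonneg _)).2 hi
    refine (pow_le_pow_left₀ (norm_nonneg _) h _).trans ?_
    rw [Real.norm_eq_abs, (even_two_mul n).pow_abs]
    exact Finset.single_le_sum hnn (Finset.mem_univ i)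

lemma summable_weight {β : ℕ} (hβ : d < 2 * β) :
    Summable fun k : Fin d → ℤ => (1 + ∑ i, (k i : ℝ) ^ (2 * β))⁻¹ := by
  let b := Pi.basisFun ℝ (Fin d)
  let L := Submodule.span ℤ (Set.range b)
  have hL : Module.finrank ℤ L = d := by
    rw [ZLattice.rank ℝ L]; simp
  have hs := ZLattice.summable_norm_pow_inv L (2 * β) (by rw [hL]; exact hβ)
  have hmem (k : Fin d → ℤ) : (fun i => (k i : ℝ)) ∈ L :=
    (b.mem_span_iff_repr_mem ℤ _).2 fun i => ⟨k i, by simp [b]⟩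
  have hinj : Function.Injective fun k : Fin d → ℤ => (⟨fun i => (k i : ℝ), hmem k⟩ : L) := by
    intro k l h
    funext i
    have := congrFun (Subtype.ext_iff.1 h) i
    exact Int.cast_injective (α := ℝ) this
  refine Summable.of_norm_bounded_eventually (hs.comp_injective hinj) ?_
  refine (Set.finite_singleton (0 : Fin d → ℤ)).subset fun k hk => ?_
  by_contra hk0
  refine hk ?_
  have hpos : 0 < ‖fun i => (k i : ℝ)‖ := norm_pos_iff.2 fun h => hk0 (by
    funext i; have := congrFun h i; simpa using this)
  have hle := norm_pow_le_sum k (n := β) (by omega)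
  have hp2 : 0 < ‖fun i => (k i : ℝ)‖ ^ (2 * β) := by positivity
  change ‖(1 + ∑ i, (k i : ℝ) ^ (2 * β))⁻¹‖ ≤ ‖(fun i => (k i : ℝ))‖⁻¹ ^ (2 * β)
  rw [Real.norm_eq_abs, abs_of_nonneg (inv_nonneg.2 (by linarith)), inv_pow]
  exact inv_anti₀ hp2 (by linarith)

lemma exists_sup_le {β : ℕ} (hβ : d < 2 * β) : ∃ C : ℝ, 0 ≤ C ∧ ∀ v : (Fin d → ℝ) → ℝ,
    ContDiff ℝ (⊤ : ℕ∞) v → ZPer v → ∀ x,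
      |v x| ≤ C + (∫ y in unitCube d, v y ^ 2) + topSq β v := by
  have hnn (k : Fin d → ℤ) : 0 ≤ ∑ i, (k i : ℝ) ^ (2 * β) :=
    Finset.sum_nonneg fun i _ => (even_two_mul β).pow_nonneg _
  refine ⟨∑' k : Fin d → ℤ, (1 + ∑ i, (k i : ℝ) ^ (2 * β))⁻¹,
    tsum_nonneg fun k => inv_nonneg.2 (by linarith [hnn k]), fun v hv hper x => ?_⟩
  obtain ⟨f, hf⟩ := exists_continuousMap_torus hv.continuous hper
  have hS := ((summable_weight hβ).hasSum.add (hasSum_coeffSq hv.continuous hper)).add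
    (hasSum_topSq hv hper β)
  have hbound (k : Fin d → ℤ) : ‖mFourierCoeff f k‖ ≤ (1 + ∑ i, (k i : ℝ) ^ (2 * β))⁻¹ +
      coeffSq v k + (∑ i, (2 * π * k i) ^ (2 * β)) * coeffSq v k := by
    have h0 : 0 ≤ ‖mFourierCoeff f k‖ := norm_nonneg _
    have h1 := norm_mFourierCoeff_sq hv.continuous hf k
    have h2 : ∑ i, (k i : ℝ) ^ (2 * β) ≤ ∑ i, (2 * π * k i) ^ (2 * β) :=
      Finset.sum_le_sum fun i _ => by
        rw [mul_pow]
        exact le_mul_of_one_le_left ((even_two_mul β).pow_nonneg _)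
          (one_le_pow₀ (by linarith [pi_gt_three]))
    rw [← h1]
    set c := ‖mFourierCoeff f k‖
    set S := ∑ i, (k i : ℝ) ^ (2 * β)
    have hw : 0 < 1 + S := by linarith [hnn k]
    have h3 : c ≤ (1 + S)⁻¹ + (1 + S) * c ^ 2 := by
      have h4 : 0 ≤ (1 + S)⁻¹ * ((1 + S) * c - 1) ^ 2 := by positivity
      have h5 : (1 + S)⁻¹ * ((1 + S) * c - 1) ^ 2 = (1 + S)⁻¹ + (1 + S) * c ^ 2 - 2 * c := by
        field_simp; ring
      linarith
    nlinarith [sq_nonneg c]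
  have hsum : Summable fun k => ‖mFourierCoeff f k‖ :=
    Summable.of_nonneg_of_le (fun _ => norm_nonneg _) hbound hS.summable
  have hx := hasSum_mFourier_series_apply_of_summable hsum.of_norm (toTorus x)
  rw [hf] at hx
  have h6 (k : Fin d → ℤ) : ‖mFourierCoeff f k • mFourier k (toTorus x)‖ =
      ‖mFourierCoeff f k‖ := by
    rw [norm_smul, mFourier_toTorus, Complex.norm_exp_ofReal_mul_I, mul_one]
  have h7 := hx.norm_le_of_bounded hsum.hasSum fun k => (h6 k).le
  rw [Complex.norm_real, Real.norm_eq_abs] at h7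
  exact h7.trans ((hsum.tsum_le_tsum hbound hS.summable).trans hS.tsum_eq.le)

lemma pder_sum {ι : Type*} (S : Finset ι) {f : ι → (Fin d → ℝ) → ℝ}
    (hf : ∀ k ∈ S, ContDiff ℝ (⊤ : ℕ∞) (f k)) (i : Fin d) :
    pder i (fun x => ∑ k ∈ S, f k x) = fun x => ∑ k ∈ S, pder i (f k) x := by
  funext x
  refine deriv_fun_sum fun k hk => ?_
  have h := (hf k hk).differentiable (by simp)
  exact (h _).fun_comp' (x i) (hasDerivAt_update x i (x i)).differentiableAt

lemma lap_sum {ι : Type*} (S : Finset ι) {f : ι → (Fin d → ℝ) → ℝ}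
    (hf : ∀ k ∈ S, ContDiff ℝ (⊤ : ℕ∞) (f k)) (x : Fin d → ℝ) :
    lap (fun x => ∑ k ∈ S, f k x) x = ∑ k ∈ S, lap (f k) x := by
  simp only [lap]
  rw [Finset.sum_comm]
  refine Finset.sum_congr rfl fun i _ => ?_
  rw [pder_sum S hf, pder_sum S fun k hk => contDiff_pder (hf k hk) i]

/-- The real wave `Re (a exp (i 2π k·x))`. -/
def wave (a : ℂ) (k : Fin d → ℤ) (x : Fin d → ℝ) : ℝ :=
  a.re * cos (phase k x) - a.im * sin (phase k x)

lemma contDiff_wave (a : ℂ) (k : Fin d → ℤ) : ContDiff ℝ (⊤ : ℕ∞) (wave a k) := by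
  have := contDiff_phase k
  unfold wave; fun_prop

lemma zPer_wave (a : ℂ) (k : Fin d → ℤ) : ZPer (wave a k) := fun x n => by
  simp only [wave, phase_add_int, cos_add_int_mul_two_pi, sin_add_int_mul_two_pi]

lemma wave_eq_re (a : ℂ) (k : Fin d → ℤ) (x : Fin d → ℝ) :
    wave a k x = (a * mFourier k (toTorus x)).re := by
  rw [mFourier_toTorus, Complex.mul_re, Complex.exp_ofReal_mul_I_re,
    Complex.exp_ofReal_mul_I_im, wave]

lemma lap_wave (a : ℂ) (k : Fin d → ℤ) (x : Fin d → ℝ) :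
    lap (wave a k) x = wave (((- ∑ i, (2 * π * k i) ^ 2 : ℝ) : ℂ) * a) k x := by
  have h (i : Fin d) : pder i (pder i (wave a k)) x = - (2 * π * k i) ^ 2 * wave a k x := by
    have h1 : pder i (wave a k) = fun x =>
        (fun y => 2 * π * k i * (a.re * -sin y - a.im * cos y)) (phase k x) := by
      funext y
      exact pder_comp_phase (fun y => ((hasDerivAt_cos y).const_mul a.re).sub
        ((hasDerivAt_sin y).const_mul a.im)) k i y
    rw [h1]
    have h2 (y : ℝ) : HasDerivAt (fun y => 2 * π * k i * (a.re * -sin y - a.im * cos y))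
        (2 * π * k i * (a.re * -cos y - a.im * -sin y)) y :=
      (((hasDerivAt_sin y).neg.const_mul a.re).sub
        ((hasDerivAt_cos y).const_mul a.im)).const_mul _
    rw [pder_comp_phase h2, wave]
    ring
  simp only [lap, h, ← Finset.sum_mul, Finset.sum_neg_distrib]
  simp only [wave, Complex.re_ofReal_mul, Complex.im_ofReal_mul]
  ring

/-- The lattice points of sup norm at most `N`. -/
def latticeBox (d : ℕ) (N : ℝ) : Finset (Fin d → ℤ) :=
  Fintype.piFinset fun _ => Finset.Icc (-⌊N⌋) ⌊N⌋

lemma mem_latticeBox {N : ℝ} {k : Fin d → ℤ} : k ∈ latticeBox d N ↔ ∀ i, |(k i : ℝ)| ≤ N := by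
  simp only [latticeBox, Fintype.mem_piFinset, Finset.mem_Icc]
  refine forall_congr' fun i => ?_
  rw [← abs_le, Int.le_floor, Int.cast_abs]

lemma integral_sq_sub_wave_le (f : C(UnitAddTorus (Fin d), ℂ)) (S : Finset (Fin d → ℤ))
    (a : (Fin d → ℤ) → ℂ) {g : (Fin d → ℤ) → ℝ} {M : ℝ} (hg : HasSum g M)
    (h : ∀ k, ‖mFourierCoeff f k - if k ∈ S then a k else 0‖ ^ 2 ≤ g k) :
    ∫ x in unitCube d, ((f (toTorus x)).re - ∑ k ∈ S, wave (a k) k x) ^ 2 ≤ M := by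
  have hP := hasSum_norm_sq_mFourierCoeff (f - ∑ j ∈ S, a j • mFourier j)
  simp only [mFourierCoeff_sub_sum] at hP
  refine le_trans ?_ (hasSum_le h hP hg)
  have htor : Continuous (toTorus (d := d)) :=
    continuous_pi fun i => (AddCircle.continuous_mk' 1).comp (continuous_apply i)
  have hw : Continuous fun x => ∑ k ∈ S, wave (a k) k x :=
    continuous_finsetSum _ fun k _ => (contDiff_wave (a k) k).continuous
  refine integral_mono (Continuous.integrableOn_unitCube (by fun_prop))
    (Continuous.integrableOn_unitCube (by fun_prop)) fun x => ?_
  have : (f (toTorus x)).re - ∑ k ∈ S, wave (a k) k x =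
      ((f - ∑ j ∈ S, a j • mFourier j : C(UnitAddTorus (Fin d), ℂ)) (toTorus x)).re := by
    simp [wave_eq_re]
  simp only [this]
  exact sq_le_sq' (neg_le_of_abs_le (Complex.abs_re_le_norm _))
    (le_of_abs_le (Complex.abs_re_le_norm _))

lemma exists_truncation (d : ℕ) : ∃ C : ℝ, 0 ≤ C ∧ ∀ (β : ℕ) (p : (Fin d → ℝ) → ℝ),
    ContDiff ℝ (⊤ : ℕ∞) p → ZPer p → ∀ N : ℝ, 1 ≤ N → ∃ φ : (Fin d → ℝ) → ℝ,
      ContDiff ℝ (⊤ : ℕ∞) φ ∧ ZPer φ ∧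
      (∫ x in unitCube d, φ x ^ 2) ≤ (∫ x in unitCube d, p x ^ 2) ∧
      (∫ x in unitCube d, lap φ x ^ 2) ≤ (C * N ^ 2) ^ 2 * (∫ x in unitCube d, p x ^ 2) ∧
      (∫ x in unitCube d, (p x - φ x) ^ 2) ≤ (N ^ (2 * β))⁻¹ * topSq β p := by
  refine ⟨d * (2 * π) ^ 2, by positivity, fun β p hp hper N hN => ?_⟩
  obtain ⟨f, hf⟩ := exists_continuousMap_torus hp.continuous hper
  have hc (k) := norm_mFourierCoeff_sq hp.continuous hf k
  have hsum := hasSum_coeffSq hp.continuous hper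
  set c := mFourierCoeff f
  set S := latticeBox d N
  have h0 (k : Fin d → ℤ) : mFourierCoeff (0 : C(UnitAddTorus (Fin d), ℂ)) k = 0 := by
    simp [mFourierCoeff]
  refine ⟨fun x => ∑ k ∈ S, wave (c k) k x,
    ContDiff.sum fun k _ => contDiff_wave _ k,
    fun x n => Finset.sum_congr rfl fun k _ => zPer_wave _ _ x n, ?_, ?_, ?_⟩
  · have := integral_sq_sub_wave_le 0 S c hsum fun k => by
      rw [h0]
      split_ifs <;> simp [hc, coeffSq_nonneg]
    simpa using this
  · have := integral_sq_sub_wave_le 0 S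
      (fun k => ((- ∑ i, (2 * π * k i) ^ 2 : ℝ) : ℂ) * c k)
      (hsum.mul_left ((d * (2 * π) ^ 2 * N ^ 2) ^ 2)) fun k => by
        rw [h0]
        split_ifs with hk
        · rw [zero_sub, norm_neg, norm_mul, mul_pow, hc, Complex.norm_real, Real.norm_eq_abs,
            abs_neg, abs_of_nonneg (by positivity)]
          refine mul_le_mul_of_nonneg_right ?_ (coeffSq_nonneg _ _)
          refine pow_le_pow_left₀ (by positivity) ?_ 2
          calc ∑ i, (2 * π * (k i : ℝ)) ^ 2 ≤ ∑ i : Fin d, (2 * π) ^ 2 * N ^ 2 :=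
                Finset.sum_le_sum fun i _ => by
                  rw [mul_pow]
                  refine mul_le_mul_of_nonneg_left ?_ (by positivity)
                  rw [← sq_abs]
                  exact pow_le_pow_left₀ (abs_nonneg _) (mem_latticeBox.1 hk i) 2
            _ = d * (2 * π) ^ 2 * N ^ 2 := by simp; ring
        · rw [sub_zero, norm_zero, zero_pow two_ne_zero]
          exact mul_nonneg (sq_nonneg _) (coeffSq_nonneg p k)
    simp only [ContinuousMap.zero_apply, Complex.zero_re, zero_sub, neg_sq, ← lap_wave] at this
    simpa only [lap_sum S fun k _ => contDiff_wave (c k) k] using this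
  · have := integral_sq_sub_wave_le f S c ((hasSum_topSq hp hper β).mul_left (N ^ (2 * β))⁻¹)
      fun k => by
        have hnn : 0 ≤ ∑ i, (2 * π * (k i : ℝ)) ^ (2 * β) :=
          Finset.sum_nonneg fun i _ => (even_two_mul β).pow_nonneg _
        have hcn := coeffSq_nonneg p k
        split_ifs with hk
        · rw [sub_self, norm_zero, zero_pow two_ne_zero]
          exact mul_nonneg (by positivity) (mul_nonneg hnn hcn)
        · rw [sub_zero, hc, ← mul_assoc]
          refine le_mul_of_one_le_left hcn ?_
          rw [inv_mul_eq_div, one_le_div (by positivity)]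
          rw [mem_latticeBox] at hk
          push Not at hk
          obtain ⟨i, hi⟩ := hk
          refine le_trans ?_ (Finset.single_le_sum
            (f := fun i => (2 * π * (k i : ℝ)) ^ (2 * β))
            (fun i _ => (even_two_mul β).pow_nonneg _) (Finset.mem_univ i))
          change _ ≤ (2 * π * (k i : ℝ)) ^ (2 * β)
          rw [← (even_two_mul β).pow_abs (2 * π * (k i : ℝ)), abs_mul,
            abs_of_pos (by positivity : (0 : ℝ) < 2 * π)]
          refine pow_le_pow_left₀ (by linarith) ?_ _
          nlinarith [pi_gt_three, abs_nonneg (k i : ℝ)]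
    simpa only [hf, Complex.ofReal_re] using this

end Fourier

section Bounds

variable {d : ℕ}

lemma foldr_iterate_pder_single (i : Fin d) (n : ℕ) (v : (Fin d → ℝ) → ℝ) (l : List (Fin d))
    (hl : l.Nodup) :
    l.foldr (fun k acc => (pder k)^[(Pi.single i n : Fin d → ℕ) k] acc) v =
      if i ∈ l then (pder i)^[n] v else v := by
  induction l with
  | nil => simp
  | cons k l ih =>
    rw [List.nodup_cons] at hl
    rw [List.foldr_cons, ih hl.2]
    by_cases hk : i = k
    · subst hk
      simp [hl.1]
    · simp [hk]

lemma mder_single (i : Fin d) (n : ℕ) (v : (Fin d → ℝ) → ℝ) :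
    mder (Pi.single i n) v = (pder i)^[n] v := by
  rw [mder, foldr_iterate_pder_single i n v _ (List.nodup_finRange d), if_pos (List.mem_finRange i)]

lemma mder_zero (v : (Fin d → ℝ) → ℝ) : mder (0 : Fin d → ℕ) v = v := by
  have : ∀ l : List (Fin d),
      l.foldr (fun k acc => (pder k)^[(0 : Fin d → ℕ) k] acc) v = v := fun l => by
    induction l with
    | nil => rfl
    | cons k l ih => rw [List.foldr_cons, ih]; rfl
  exact this _

lemma integral_mder_sq_le_hSobSq {β : ℕ} (v : (Fin d → ℝ) → ℝ) (j : Fin d → ℕ)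
    (hj : ∑ i, j i ≤ β) : ∫ x in unitCube d, mder j v x ^ 2 ≤ hSobSq β v := by
  have hlt (i : Fin d) : j i < β + 1 :=
    Nat.lt_succ_of_le
      ((Finset.single_le_sum (fun _ _ => Nat.zero_le _) (Finset.mem_univ i)).trans hj)
  exact Finset.single_le_sum
    (f := fun j : Fin d → Fin (β + 1) => ∫ x in unitCube d, mder (fun i => (j i : ℕ)) v x ^ 2)
    (fun _ _ => integral_nonneg fun _ => sq_nonneg _)
    (Finset.mem_filter.2 ⟨Finset.mem_univ (fun i => (⟨j i, hlt i⟩ : Fin (β + 1))), hj⟩)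

lemma hSobSq_le_of_hSob_le {β : ℕ} {v : (Fin d → ℝ) → ℝ} {R : ℝ} (h : hSob β v ≤ R) :
    hSobSq β v ≤ R ^ 2 :=
  (Real.sqrt_le_iff.1 h).2

lemma integral_sq_le_of_hSob_le {β : ℕ} {v : (Fin d → ℝ) → ℝ} {R : ℝ} (h : hSob β v ≤ R) :
    ∫ x in unitCube d, v x ^ 2 ≤ R ^ 2 := by
  have := integral_mder_sq_le_hSobSq (β := β) v 0 (by simp)
  rw [mder_zero] at this
  exact this.trans (hSobSq_le_of_hSob_le h)

lemma topSq_le_of_hSob_le {β : ℕ} {v : (Fin d → ℝ) → ℝ} {R : ℝ} (h : hSob β v ≤ R) :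
    topSq β v ≤ d * R ^ 2 := by
  calc topSq β v ≤ ∑ _i : Fin d, R ^ 2 := Finset.sum_le_sum fun i _ => by
        have := integral_mder_sq_le_hSobSq (β := β) v (Pi.single i β) (by simp)
        rw [mder_single] at this
        exact this.trans (hSobSq_le_of_hSob_le h)
    _ = d * R ^ 2 := by simp

lemma iterate_pder_sub {v w : (Fin d → ℝ) → ℝ} (hv : ContDiff ℝ (⊤ : ℕ∞) v)
    (hw : ContDiff ℝ (⊤ : ℕ∞) w) (i : Fin d) (n : ℕ) :
    (pder i)^[n] (fun x => v x - w x) = fun x => (pder i)^[n] v x - (pder i)^[n] w x := by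
  induction n with
  | zero => rfl
  | succ n ih =>
    funext x
    simp only [Function.iterate_succ_apply', ih]
    exact pder_sub (contDiff_iterate_pder hv i n) (contDiff_iterate_pder hw i n) i x

lemma topSq_sub_le {v w : (Fin d → ℝ) → ℝ} (hv : ContDiff ℝ (⊤ : ℕ∞) v)
    (hw : ContDiff ℝ (⊤ : ℕ∞) w) (β : ℕ) :
    topSq β (fun x => v x - w x) ≤ 2 * topSq β v + 2 * topSq β w := by
  simp only [topSq, Finset.mul_sum, ← Finset.sum_add_distrib]
  refine Finset.sum_le_sum fun i _ => ?_
  have h1 := (contDiff_iterate_pder hv i β).continuous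
  have h2 := (contDiff_iterate_pder hw i β).continuous
  rw [iterate_pder_sub hv hw, ← integral_const_mul, ← integral_const_mul, ← integral_add
    (Continuous.integrableOn_unitCube (by fun_prop))
    (Continuous.integrableOn_unitCube (by fun_prop))]
  refine integral_mono (Continuous.integrableOn_unitCube (by fun_prop))
    (Continuous.integrableOn_unitCube (by fun_prop)) fun x => ?_
  nlinarith [sq_nonneg ((pder i)^[β] v x + (pder i)^[β] w x)]

lemma LinkFun.exists_bounds (Φ : LinkFun) (M : ℝ) : ∃ c > (0 : ℝ), ∃ C > (0 : ℝ),
    (∀ a, |a| ≤ M → |Φ.toFun a| ≤ C) ∧ ∀ a b, |a| ≤ M → |b| ≤ M →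
      c * (a - b) ^ 2 ≤ (Φ.toFun a - Φ.toFun b) * (a - b) ∧
      |Φ.toFun a - Φ.toFun b| ≤ C * |a - b| := by
  have hdiff : Differentiable ℝ Φ.toFun := Φ.smooth.differentiable (by simp)
  have hcd : Continuous (deriv Φ.toFun) := Φ.smooth.continuous_deriv (by simp)
  rcases lt_or_ge M 0 with hM | hM
  · exact ⟨1, one_pos, 1, one_pos, fun a ha => absurd ((abs_nonneg a).trans ha) (not_le.2 hM),
      fun a _ ha => absurd ((abs_nonneg a).trans ha) (not_le.2 hM)⟩
  have hne : (Set.Icc (-M) M).Nonempty := ⟨0, by simp [hM]⟩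
  obtain ⟨x₀, -, hx₀⟩ := isCompact_Icc.exists_isMinOn hne hcd.continuousOn
  obtain ⟨C₁, hC₁⟩ := isCompact_Icc.exists_bound_of_continuousOn (s := Set.Icc (-M) M)
    hcd.continuousOn
  obtain ⟨C₂, hC₂⟩ := isCompact_Icc.exists_bound_of_continuousOn (s := Set.Icc (-M) M)
    Φ.smooth.continuous.continuousOn
  have key : ∀ a b, |a| ≤ M → |b| ≤ M → a ≤ b →
      deriv Φ.toFun x₀ * (b - a) ≤ Φ.toFun b - Φ.toFun a ∧
      Φ.toFun b - Φ.toFun a ≤ C₁ * (b - a) := fun a b ha hb hab =>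
    ⟨(convex_Icc (-M) M).mul_sub_le_image_sub_of_le_deriv hdiff.continuous.continuousOn
      hdiff.differentiableOn (fun x hx => hx₀ (interior_subset hx)) a (abs_le.1 ha) b
      (abs_le.1 hb) hab,
    (convex_Icc (-M) M).image_sub_le_mul_sub_of_deriv_le hdiff.continuous.continuousOn
      hdiff.differentiableOn (fun x hx => (le_abs_self _).trans (hC₁ x (interior_subset hx))) a
      (abs_le.1 ha) b (abs_le.1 hb) hab⟩
  have hc := Φ.deriv_pos x₀
  refine ⟨deriv Φ.toFun x₀, hc, max (max C₁ C₂) 1, by positivity,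
    fun a ha => (hC₂ a (abs_le.1 ha)).trans ((le_max_right _ _).trans (le_max_left _ _)),
    fun a b ha hb => ?_⟩
  have hmax : C₁ ≤ max (max C₁ C₂) 1 := (le_max_left _ _).trans (le_max_left _ _)
  rcases le_total a b with hab | hab
  · obtain ⟨h1, h2⟩ := key a b ha hb hab
    refine ⟨by nlinarith, ?_⟩
    rw [abs_sub_comm, abs_sub_comm a b, abs_of_nonneg (a := b - a) (by linarith),
      abs_of_nonneg (by nlinarith)]
    nlinarith
  · obtain ⟨h1, h2⟩ := key b a hb ha hab
    refine ⟨by nlinarith, ?_⟩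
    rw [abs_of_nonneg (a := a - b) (by linarith), abs_of_nonneg (by nlinarith)]
    nlinarith

lemma exists_mem_unitCube_eq (x : Fin d → ℝ) :
    ∃ y ∈ unitCube d, ∀ F : (Fin d → ℝ) → ℝ, ZPer F → F x = F y := by
  refine ⟨fun i => Int.fract (x i), ⟨fun i => Int.fract_nonneg _, fun i => (Int.fract_lt_one _).le⟩,
    fun F hF => ?_⟩
  rw [← hF (fun i => Int.fract (x i)) fun i => ⌊x i⌋]
  simp only [Int.fract_add_floor]

lemma exists_time_lower_bound {T m : ℝ} (hT : 0 < T) {u : (Fin d → ℝ) → ℝ → ℝ}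
    (hu : Continuous fun p : (Fin d → ℝ) × ℝ => u p.1 p.2) (hper : ZPerSpace u)
    (h0 : ∀ x, m < u x 0) :
    ∃ T' > (0 : ℝ), T' ≤ T ∧ ∀ x, ∀ t ∈ Set.Icc 0 T', m ≤ u x t := by
  have hK : IsCompact (unitCube d) := isCompact_Icc
  obtain ⟨U, V, -, hV, hUs, hVs, hsub⟩ := generalized_tube_lemma hK
    (isCompact_singleton (x := (0 : ℝ)))
    (isOpen_lt continuous_const hu : IsOpen {p : (Fin d → ℝ) × ℝ | m < u p.1 p.2})
    (fun p hp => by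
      obtain ⟨-, hp2⟩ := hp
      rw [Set.mem_singleton_iff] at hp2
      simpa [hp2] using h0 p.1)
  obtain ⟨ε, hε, hball⟩ := Metric.isOpen_iff.1 hV 0 (hVs rfl)
  refine ⟨min (ε / 2) T, by positivity, min_le_right _ _, fun x t ht => ?_⟩
  obtain ⟨y, hy, hxy⟩ := exists_mem_unitCube_eq x
  rw [hxy (fun x => u x t) (hper t)]
  have ht' : t ∈ V := hball (by
    rw [Metric.mem_ball, Real.dist_eq, sub_zero, abs_of_nonneg ht.1]
    linarith [ht.2.trans (min_le_left _ _)])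
  exact (hsub (Set.mk_mem_prod (hUs hy) ht')).le

lemma eq_zero_of_integral_volQ_eq_zero {T : ℝ} (hT : 0 < T) {K : (Fin d → ℝ) × ℝ → ℝ}
    (hK : Continuous K) (hnn : ∀ p, 0 ≤ K p) (h : ∫ p, K p ∂volQ d T = 0) :
    ∀ x ∈ unitCube d, ∀ t ∈ Set.Ioc 0 T, K (x, t) = 0 := by
  have hae := (integral_eq_zero_iff_of_nonneg hnn (integrable_volQ T hK)).1 h
  rw [volQ_eq_restrict] at hae
  have hcl : unitCube d ×ˢ Set.Ioc 0 T ⊆ closure (interior (unitCube d ×ˢ Set.Ioc 0 T)) := by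
    rw [interior_prod_eq, closure_prod_eq, interior_Ioc, closure_Ioo hT.ne, unitCube,
      ← Set.pi_univ_Icc, interior_pi_set Set.finite_univ, closure_pi_set]
    refine Set.prod_mono (Set.pi_mono fun i _ => ?_) Set.Ioc_subset_Icc_self
    rw [interior_Icc, Pi.zero_apply, Pi.one_apply, closure_Ioo zero_ne_one]
  intro x hx t ht
  exact Measure.eqOn_of_ae_eq hae hK.continuousOn continuousOn_const hcl (Set.mk_mem_prod hx ht)

end Bounds

section Estimates

variable {d : ℕ}

lemma HeatSol.mono {T T' θ : ℝ} {f u0 : (Fin d → ℝ) → ℝ} {u : (Fin d → ℝ) → ℝ → ℝ}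
    (h : HeatSol T θ f u0 u) (hT : T' ≤ T) : HeatSol T' θ f u0 u :=
  ⟨h.1, h.2.1, fun x t ht => h.2.2.1 x t ⟨ht.1, ht.2.trans hT⟩, h.2.2.2⟩

lemma integral_volQ_sq_le_of_l2Q_le {T T' δ : ℝ} (hT : T' ≤ T) {w : (Fin d → ℝ) → ℝ → ℝ}
    (hw : SmoothQ w) (h : l2Q T w ≤ δ) : ∫ p, w p.1 p.2 ^ 2 ∂volQ d T' ≤ δ ^ 2 := by
  have h1 := (Real.sqrt_le_iff.1 h).2
  have hc : Continuous fun p : (Fin d → ℝ) × ℝ => w p.1 p.2 ^ 2 := hw.cont.pow 2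
  rw [← integral_volQ_symm (K := fun x t => w x t ^ 2) hc] at h1
  refine le_trans ?_ h1
  refine integral_mono_measure ?_ (Eventually.of_forall fun p => sq_nonneg _)
    (integrable_volQ T hc)
  rw [volQ_eq_restrict, volQ_eq_restrict]
  exact Measure.restrict_mono (Set.prod_mono le_rfl (Set.Ioc_subset_Ioc_right hT)) le_rfl

/-- A squared parabolic norm controlling the adjoint operator. -/
noncomputable def testSq (T A B : ℝ) (ψ : (Fin d → ℝ) → ℝ → ℝ) : ℝ :=
  3 * (A ^ 2 * (∫ p, ψ p.1 p.2 ^ 2 ∂volQ d T) +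
    B ^ 2 * (∫ p, lap (fun y => ψ y p.2) p.1 ^ 2 ∂volQ d T) +
    ∫ p, deriv (ψ p.1) p.2 ^ 2 ∂volQ d T)

lemma integral_adjOp_sq_le {T A B θ : ℝ} {f : (Fin d → ℝ) → ℝ} (hf : Continuous f)
    (hfA : ∀ x, |f x| ≤ A) (hθB : |θ| ≤ B) {ψ : (Fin d → ℝ) → ℝ → ℝ} (hψ : SmoothQ ψ) :
    ∫ p, adjOp θ f ψ p.1 p.2 ^ 2 ∂volQ d T ≤ testSq T A B ψ := by
  have h1 : Integrable (fun p : (Fin d → ℝ) × ℝ => ψ p.1 p.2 ^ 2) (volQ d T) :=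
    integrable_volQ T (hψ.cont.pow 2)
  have h2 : Integrable (fun p : (Fin d → ℝ) × ℝ => lap (fun y => ψ y p.2) p.1 ^ 2) (volQ d T) :=
    integrable_volQ T (hψ.lap.cont.pow 2)
  have h3 : Integrable (fun p : (Fin d → ℝ) × ℝ => deriv (ψ p.1) p.2 ^ 2) (volQ d T) :=
    integrable_volQ T (hψ.deriv.cont.pow 2)
  rw [testSq, ← integral_const_mul, ← integral_const_mul, ← integral_add (h1.const_mul _)
    (h2.const_mul _), ← integral_add ((h1.const_mul _).fun_add (h2.const_mul _)) h3,
    ← integral_const_mul]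
  refine integral_mono (integrable_volQ T ((continuous_adjOp hf hψ).pow 2))
    ((((h1.const_mul _).fun_add (h2.const_mul _)).fun_add h3).const_mul _) fun p => ?_
  change (f p.1 * ψ p.1 p.2 - θ / 2 * lap (fun y => ψ y p.2) p.1 - deriv (ψ p.1) p.2) ^ 2 ≤
    3 * (A ^ 2 * ψ p.1 p.2 ^ 2 + B ^ 2 * lap (fun y => ψ y p.2) p.1 ^ 2 + deriv (ψ p.1) p.2 ^ 2)
  set a := ψ p.1 p.2
  set b := lap (fun y => ψ y p.2) p.1
  set c := deriv (ψ p.1) p.2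
  have hA : f p.1 ^ 2 ≤ A ^ 2 := sq_le_sq.2 ((hfA p.1).trans (le_abs_self A))
  have hB : θ ^ 2 ≤ B ^ 2 := sq_le_sq.2 (hθB.trans (le_abs_self B))
  have h4 : (f p.1 * a - θ / 2 * b - c) ^ 2 ≤
      3 * ((f p.1 * a) ^ 2 + (θ / 2 * b) ^ 2 + c ^ 2) := by
    nlinarith [sq_nonneg (f p.1 * a + θ / 2 * b), sq_nonneg (f p.1 * a + c),
      sq_nonneg (θ / 2 * b - c)]
  have h5 : (f p.1 * a) ^ 2 ≤ A ^ 2 * a ^ 2 := by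
    rw [mul_pow]; exact mul_le_mul_of_nonneg_right hA (sq_nonneg a)
  have h6 : (θ / 2 * b) ^ 2 ≤ B ^ 2 * b ^ 2 := by
    rw [mul_pow]; refine mul_le_mul_of_nonneg_right ?_ (sq_nonneg b); nlinarith [sq_nonneg θ]
  linarith

/-- The weak bound on the forcing of the difference of two solutions. -/
def ForcingBound (T A B τ δ : ℝ) (q : (Fin d → ℝ) → ℝ) (us : (Fin d → ℝ) → ℝ → ℝ) : Prop :=
  ∀ ψ : (Fin d → ℝ) → ℝ → ℝ, SmoothQ ψ → ZPerSpace ψ → (∀ x, ψ x T = 0) →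
    |∫ p, (τ / 2 * lap (fun y => us y p.2) p.1 - q p.1 * us p.1 p.2) * ψ p.1 p.2 ∂volQ d T| ≤
      δ * √(testSq T A B ψ)

lemma forcingBound_of_heatSol {T A B θ θ₀ δ : ℝ} (hT : 0 ≤ T) (hδ : 0 ≤ δ)
    {f f₀ u0 : (Fin d → ℝ) → ℝ} (hf : Continuous f) (hf₀ : Continuous f₀)
    (hfA : ∀ x, |f x| ≤ A) (hθB : |θ| ≤ B) {u us : (Fin d → ℝ) → ℝ → ℝ}
    (hu : HeatSol T θ f u0 u) (hus : HeatSol T θ₀ f₀ u0 us)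
    (hw : ∫ p, (u p.1 p.2 - us p.1 p.2) ^ 2 ∂volQ d T ≤ δ ^ 2) :
    ForcingBound T A B (θ - θ₀) δ (fun x => f x - f₀ x) us := by
  intro ψ hψ hψper hψT
  have hws : SmoothQ fun x t => u x t - us x t := hu.1.sub hus.1
  have hadj : Continuous fun p : (Fin d → ℝ) × ℝ => adjOp θ f ψ p.1 p.2 := continuous_adjOp hf hψ
  have hg : Continuous fun p : (Fin d → ℝ) × ℝ =>
      (θ - θ₀) / 2 * lap (fun y => us y p.2) p.1 - (f p.1 - f₀ p.1) * us p.1 p.2 :=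
    (continuous_const.mul hus.1.lap.cont).sub
      (((hf.comp continuous_fst).sub (hf₀.comp continuous_fst)).mul hus.1.cont)
  rw [integral_forcing_mul (θ := θ) hT hf hws (hu.2.1.sub hus.2.1) hψ hψper
    (g := fun x t => (θ - θ₀) / 2 * lap (fun y => us y t) x - (f x - f₀ x) * us x t) hg ?_ ?_ hψT]
  · refine (abs_integral_mul_le (integrable_volQ T (hws.cont.pow 2))
      (integrable_volQ T (hadj.pow 2)) (integrable_volQ T (hws.cont.mul hadj))).trans ?_
    exact mul_le_mul (Real.sqrt_le_iff.2 ⟨hδ, hw⟩)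
      (Real.sqrt_le_sqrt (integral_adjOp_sq_le hf hfA hθB hψ)) (Real.sqrt_nonneg _) hδ
  · intro x t ht
    have h1 := ((hu.1.hasDerivAt x t).sub (hus.1.hasDerivAt x t)).deriv
    have h2 : deriv (fun s => u x s - us x s) t = deriv (u x) t - deriv (us x) t := h1
    rw [h2, hu.2.2.1 x t ht, hus.2.2.1 x t ht, lap_sub (hu.1.space t) (hus.1.space t)]
    ring
  · intro x
    rw [hu.2.2.2, hus.2.2.2, sub_self]

/-- The test function annihilating every time-independent potential perturbation. -/
noncomputable def wronskianTest (u σ : (Fin d → ℝ) → ℝ → ℝ) (x : Fin d → ℝ) (t : ℝ) : ℝ :=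
  2 * deriv (u x) t * σ x t + u x t * deriv (σ x) t

lemma smoothQ_wronskianTest {u σ : (Fin d → ℝ) → ℝ → ℝ} (hu : SmoothQ u) (hσ : SmoothQ σ) :
    SmoothQ (wronskianTest u σ) :=
  ((hu.deriv.const_mul 2).mul hσ).add (hu.mul hσ.deriv)

lemma zPerSpace_wronskianTest {u σ : (Fin d → ℝ) → ℝ → ℝ} (hu : ZPerSpace u)
    (hσ : ZPerSpace σ) : ZPerSpace (wronskianTest u σ) :=
  ((hu.deriv.const_mul 2).mul hσ).add (hu.mul hσ.deriv)

lemma integral_potential_mul_wronskianTest {T : ℝ} (hT : 0 ≤ T) {q : (Fin d → ℝ) → ℝ}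
    (hq : ContDiff ℝ (⊤ : ℕ∞) q) {u σ : (Fin d → ℝ) → ℝ → ℝ} (hu : SmoothQ u) (hσ : SmoothQ σ)
    (hσ0 : ∀ x, σ x 0 = 0) (hσT : ∀ x, σ x T = 0) :
    ∫ p, q p.1 * u p.1 p.2 * wronskianTest u σ p.1 p.2 ∂volQ d T = 0 := by
  have hK : SmoothQ fun x t => q x * (u x t * u x t * σ x t) :=
    (SmoothQ.of_space hq).mul ((hu.mul hu).mul hσ)
  rw [← integral_volQ_deriv hT hK (by simp [hσ0]) (by simp [hσT])]
  refine integral_congr_ae (Eventually.of_forall fun p => ?_)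
  have h := ((((hu.hasDerivAt p.1 p.2).mul (hu.hasDerivAt p.1 p.2)).mul
    (hσ.hasDerivAt p.1 p.2)).const_mul (q p.1)).deriv
  refine Eq.trans ?_ h.symm
  simp only [wronskianTest, Pi.mul_apply]
  ring

lemma integral_lap_mul_wronskianTest {T : ℝ} (hT : 0 ≤ T) {u σ : (Fin d → ℝ) → ℝ → ℝ}
    (hu : SmoothQ u) (hσ : SmoothQ σ) (hσ0 : ∀ x, σ x 0 = 0) (hσT : ∀ x, σ x T = 0) :
    ∫ p, lap (fun y => u y p.2) p.1 * wronskianTest u σ p.1 p.2 ∂volQ d T =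
      - ∫ p, lapWronskian u p.1 p.2 * σ p.1 p.2 ∂volQ d T := by
  have hK : SmoothQ fun x t => lap (fun y => u y t) x * u x t * σ x t :=
    (hu.lap.mul hu).mul hσ
  have h0 := integral_volQ_deriv hT hK (by simp [hσ0]) (by simp [hσT])
  have hψ := smoothQ_wronskianTest hu hσ
  have hW := smoothQ_lapWronskian hu
  rw [eq_neg_iff_add_eq_zero, ← integral_add (integrable_volQ T (hu.lap.mul hψ).cont)
    (integrable_volQ T (hW.mul hσ).cont), ← h0]
  refine integral_congr_ae (Eventually.of_forall fun p => ?_)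
  have h := (((hu.lap.hasDerivAt p.1 p.2).mul (hu.hasDerivAt p.1 p.2)).mul
    (hσ.hasDerivAt p.1 p.2)).deriv
  refine Eq.trans ?_ h.symm
  simp only [wronskianTest, lapWronskian, Pi.mul_apply]
  ring

/-- The diffusivity is Lipschitz-identifiable if `Δu* / u*` depends on time. -/
lemma exists_diffusivity_bound {T : ℝ} (hT : 0 < T) {us : (Fin d → ℝ) → ℝ → ℝ}
    (hus : SmoothQ us) (hper : ZPerSpace us)
    (hW : ∃ x, ∃ t ∈ Set.Ioo 0 T, lapWronskian us x t ≠ 0) (A B : ℝ) :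
    ∃ K ≥ (0 : ℝ), ∀ (τ δ : ℝ) (q : (Fin d → ℝ) → ℝ), ContDiff ℝ (⊤ : ℕ∞) q →
      ForcingBound T A B τ δ q us → |τ| ≤ K * δ := by
  have hWs := smoothQ_lapWronskian hus
  let σ : (Fin d → ℝ) → ℝ → ℝ := fun x t => (t * (T - t)) ^ 2 * lapWronskian us x t
  have hη : ContDiff ℝ (⊤ : ℕ∞) fun t : ℝ => (t * (T - t)) ^ 2 := by fun_prop
  have hσ : SmoothQ σ := (SmoothQ.of_time hη).mul hWs
  have hσper : ZPerSpace σ := (ZPerSpace.of_time _).mul (zPerSpace_lapWronskian hper)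
  have hσ0 : ∀ x, σ x 0 = 0 := fun x => by simp [σ]
  have hσT : ∀ x, σ x T = 0 := fun x => by simp [σ]
  have hψT : ∀ x, wronskianTest us σ x T = 0 := fun x => by
    have h := (((((hasDerivAt_id T).mul ((hasDerivAt_id T).const_sub T)).pow 2)).mul
      (hWs.hasDerivAt x T)).deriv
    have h2 : deriv (σ x) T = 0 := by
      refine Eq.trans h ?_
      simp
    simp [wronskianTest, h2, hσT]
  set I := ∫ p, lapWronskian us p.1 p.2 * σ p.1 p.2 ∂volQ d T with hI
  have hnn : ∀ p : (Fin d → ℝ) × ℝ, 0 ≤ lapWronskian us p.1 p.2 * σ p.1 p.2 := fun p => by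
    have : lapWronskian us p.1 p.2 * σ p.1 p.2 =
        (p.2 * (T - p.2) * lapWronskian us p.1 p.2) ^ 2 := by simp only [σ]; ring
    rw [this]; positivity
  have hIpos : 0 < I := by
    refine lt_of_le_of_ne (integral_nonneg hnn) fun h => ?_
    obtain ⟨x, t, ht, hne⟩ := hW
    obtain ⟨y, hy, hxy⟩ := exists_mem_unitCube_eq x
    rw [hxy _ (zPerSpace_lapWronskian hper t)] at hne
    have h0 := eq_zero_of_integral_volQ_eq_zero hT (hWs.mul hσ).cont hnn h.symm y hy t
      ⟨ht.1, ht.2.le⟩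
    have h1 : t * (T - t) ≠ 0 := mul_ne_zero ht.1.ne' (sub_pos.2 ht.2).ne'
    exact mul_ne_zero hne (mul_ne_zero (pow_ne_zero 2 h1) hne) h0
  refine ⟨2 / I * √(testSq T A B (wronskianTest us σ)), by positivity, fun τ δ q hq hF => ?_⟩
  have h := hF _ (smoothQ_wronskianTest hus hσ) (zPerSpace_wronskianTest hper hσper) hψT
  have hψ := smoothQ_wronskianTest hus hσ
  have hi1 := integrable_volQ T ((hus.lap.mul hψ).const_mul (τ / 2)).cont
  have hi2 := integrable_volQ T (((SmoothQ.of_space hq).mul hus).mul hψ).cont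
  have heq : ∫ p, (τ / 2 * lap (fun y => us y p.2) p.1 - q p.1 * us p.1 p.2) *
      wronskianTest us σ p.1 p.2 ∂volQ d T = - (τ / 2 * I) := by
    simp only [sub_mul, mul_assoc] at hi1 hi2 ⊢
    rw [integral_sub hi1 hi2, integral_const_mul,
      integral_lap_mul_wronskianTest hT.le hus hσ hσ0 hσT]
    have := integral_potential_mul_wronskianTest hT.le hq hus hσ hσ0 hσT
    simp only [mul_assoc] at this
    rw [this]
    ring
  rw [heq, abs_neg, abs_mul, abs_div, abs_of_pos hIpos, abs_of_pos (two_pos : (0 : ℝ) < 2)] at h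
  have h3 : |τ| = 2 / I * (|τ| / 2 * I) := by field_simp
  rw [h3, mul_assoc]
  exact mul_le_mul_of_nonneg_left (h.trans (mul_comm _ _).le) (by positivity)

end Estimates

section Potential

variable {d : ℕ}

lemma integral_volQ_mul (T : ℝ) (f : (Fin d → ℝ) → ℝ) (η : ℝ → ℝ) :
    ∫ p, f p.1 * η p.2 ∂volQ d T =
      (∫ x in unitCube d, f x) * ∫ t in Set.Ioc 0 T, η t :=
  integral_prod_mul f η

lemma integral_Ioc_sub {T : ℝ} (hT : 0 ≤ T) : ∫ t in Set.Ioc 0 T, (T - t) = T ^ 2 / 2 := by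
  rw [← intervalIntegral.integral_of_le hT, intervalIntegral.integral_sub (by simp) (by simp)]
  simp
  ring

lemma integral_Ioc_sub_sq_le {T : ℝ} (hT : 0 ≤ T) :
    ∫ t in Set.Ioc 0 T, (T - t) ^ 2 ≤ T ^ 3 := by
  have h : ∫ t in Set.Ioc 0 T, (T - t) ^ 2 ≤ ∫ _t in Set.Ioc (0 : ℝ) T, T ^ 2 := by
    refine setIntegral_mono_on ?_ ?_ measurableSet_Ioc fun t ht => ?_
    · exact ((by fun_prop : Continuous fun t : ℝ => (T - t) ^ 2).integrableOn_Icc).mono_set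
        Set.Ioc_subset_Icc_self
    · exact integrableOn_const (by simp)
    · exact pow_le_pow_left₀ (sub_nonneg.2 ht.2) (by linarith [ht.1]) 2
  refine h.trans (le_of_eq ?_)
  simp [hT]
  ring

lemma testSq_linear_le {T A B C N P : ℝ} (hT : 0 ≤ T) (hN : 1 ≤ N) {φ : (Fin d → ℝ) → ℝ}
    (hφ : ∫ x in unitCube d, φ x ^ 2 ≤ P)
    (hφ2 : ∫ x in unitCube d, lap φ x ^ 2 ≤ (C * N ^ 2) ^ 2 * P) :
    testSq T A B (fun x t => (T - t) * φ x) ≤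
      3 * (A ^ 2 * T ^ 3 + B ^ 2 * T ^ 3 * C ^ 2 + T) * (N ^ 2) ^ 2 * P := by
  have hφ0 : 0 ≤ ∫ x in unitCube d, φ x ^ 2 := integral_nonneg fun x => sq_nonneg _
  have hP : 0 ≤ P := hφ0.trans hφ
  have hη0 : 0 ≤ ∫ t in Set.Ioc 0 T, (T - t) ^ 2 := integral_nonneg fun t => sq_nonneg _
  have hη := integral_Ioc_sub_sq_le hT
  have hN2 : 1 ≤ (N ^ 2) ^ 2 := one_le_pow₀ (one_le_pow₀ hN)
  have e1 : ∫ p : (Fin d → ℝ) × ℝ, ((T - p.2) * φ p.1) ^ 2 ∂volQ d T ≤ P * T ^ 3 := by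
    simp only [mul_pow, mul_comm ((T - _) ^ 2)]
    rw [integral_volQ_mul T (fun x => φ x ^ 2) (fun t => (T - t) ^ 2)]
    exact mul_le_mul hφ hη hη0 hP
  have e2 : ∫ p : (Fin d → ℝ) × ℝ, lap (fun y => (T - p.2) * φ y) p.1 ^ 2 ∂volQ d T ≤
      (C * N ^ 2) ^ 2 * P * T ^ 3 := by
    simp only [lap_const_mul, mul_pow, mul_comm ((T - _) ^ 2)]
    rw [integral_volQ_mul T (fun x => lap φ x ^ 2) (fun t => (T - t) ^ 2)]
    rw [mul_pow] at hφ2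
    exact mul_le_mul hφ2 hη hη0 (by positivity)
  have e3 : ∫ p : (Fin d → ℝ) × ℝ, deriv (fun t => (T - t) * φ p.1) p.2 ^ 2 ∂volQ d T ≤
      P * T := by
    have h : ∀ p : (Fin d → ℝ) × ℝ, deriv (fun t => (T - t) * φ p.1) p.2 ^ 2 =
        φ p.1 ^ 2 * 1 := fun p => by
      rw [(((hasDerivAt_id' p.2).const_sub T).mul_const (φ p.1)).deriv]
      ring
    simp only [h]
    rw [integral_volQ_mul T (fun x => φ x ^ 2) (fun _ => 1)]
    simpa [hT] using mul_le_mul_of_nonneg_right hφ hT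
  have f1 : P * T ^ 3 ≤ (N ^ 2) ^ 2 * (P * T ^ 3) :=
    le_mul_of_one_le_left (by positivity) hN2
  have f3 : P * T ≤ (N ^ 2) ^ 2 * (P * T) := le_mul_of_one_le_left (by positivity) hN2
  have g1 := mul_le_mul_of_nonneg_left (e1.trans f1) (sq_nonneg A)
  have g2 := mul_le_mul_of_nonneg_left e2 (sq_nonneg B)
  have g3 := e3.trans f3
  rw [testSq]
  linear_combination 3 * g1 + 3 * g2 + 3 * g3

lemma exists_abs_le_volQ (T : ℝ) {K : (Fin d → ℝ) × ℝ → ℝ} (hK : Continuous K) :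
    ∃ U ≥ (0 : ℝ), ∀ᵐ p ∂volQ d T, |K p| ≤ U := by
  obtain ⟨U, hU⟩ := (isCompact_Icc.prod isCompact_Icc :
    IsCompact (unitCube d ×ˢ Set.Icc 0 T)).exists_bound_of_continuousOn hK.continuousOn
  refine ⟨max U 0, le_max_right _ _, ?_⟩
  filter_upwards [ae_volQ T] with p hp
  exact (hU p ⟨hp.1, Set.Ioc_subset_Icc_self hp.2⟩).trans (le_max_left _ _)

/-- The coercive lower bound for the potential tested against `(T - t) p`. -/
lemma integral_potential_lower_bound {T m c : ℝ} (hT : 0 ≤ T) (hc : 0 ≤ c)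
    {us : (Fin d → ℝ) → ℝ → ℝ} (hus : SmoothQ us) (hm : 0 ≤ m)
    (hlow : ∀ x, ∀ t ∈ Set.Icc 0 T, m ≤ us x t) {q p : (Fin d → ℝ) → ℝ}
    (hq : Continuous q) (hp : Continuous p) (hqp : ∀ x, c * p x ^ 2 ≤ q x * p x) :
    c * m * (T ^ 2 / 2) * (∫ x in unitCube d, p x ^ 2) ≤
      ∫ z, q z.1 * us z.1 z.2 * ((T - z.2) * p z.1) ∂volQ d T := by
  have h : c * m * (T ^ 2 / 2) * (∫ x in unitCube d, p x ^ 2) =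
      ∫ z : (Fin d → ℝ) × ℝ, c * m * (p z.1 ^ 2 * (T - z.2)) ∂volQ d T := by
    rw [integral_const_mul, integral_volQ_mul T (fun x => p x ^ 2) (fun t => T - t),
      integral_Ioc_sub hT]
    ring
  have husc := hus.cont
  rw [h]
  refine integral_mono_ae (integrable_volQ T (by fun_prop)) (integrable_volQ T (by fun_prop)) ?_
  filter_upwards [ae_volQ T] with z hz
  have h1 := hlow z.1 z.2 (Set.Ioc_subset_Icc_self hz.2)
  have h2 := hqp z.1
  have h3 : 0 ≤ T - z.2 := sub_nonneg.2 hz.2.2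
  calc c * m * (p z.1 ^ 2 * (T - z.2)) = (c * p z.1 ^ 2) * m * (T - z.2) := by ring
    _ ≤ (q z.1 * p z.1) * us z.1 z.2 * (T - z.2) := by
      refine mul_le_mul_of_nonneg_right (mul_le_mul h2 h1 hm ?_) h3
      exact (by positivity : 0 ≤ c * p z.1 ^ 2).trans h2
    _ = _ := by ring

/-- The error made by replacing `p` with a truncation `φ` in the test function. -/
lemma integral_potential_error {T U Cq : ℝ} (hT : 0 ≤ T) (hCq : 0 ≤ Cq) (hU0 : 0 ≤ U)
    {us : (Fin d → ℝ) → ℝ → ℝ} (hus : SmoothQ us)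
    (hU : ∀ᵐ z ∂volQ d T, |(T - z.2) * us z.1 z.2| ≤ U) {q p e : (Fin d → ℝ) → ℝ}
    (hq : Continuous q) (hp : Continuous p) (he : Continuous e)
    (hqp : ∀ x, |q x| ≤ Cq * |p x|) :
    ∫ z, q z.1 * us z.1 z.2 * ((T - z.2) * e z.1) ∂volQ d T ≤
      Cq * U * T * (√(∫ x in unitCube d, p x ^ 2) * √(∫ x in unitCube d, e x ^ 2)) := by
  have husc := hus.cont
  have h1 : ∫ z, q z.1 * us z.1 z.2 * ((T - z.2) * e z.1) ∂volQ d T ≤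
      ∫ z : (Fin d → ℝ) × ℝ, Cq * U * (|p z.1| * |e z.1| * 1) ∂volQ d T := by
    refine integral_mono_ae (integrable_volQ T (by fun_prop)) (integrable_volQ T (by fun_prop)) ?_
    filter_upwards [hU] with z hz
    calc q z.1 * us z.1 z.2 * ((T - z.2) * e z.1)
        ≤ |q z.1| * |(T - z.2) * us z.1 z.2| * |e z.1| := by
          rw [← abs_mul, ← abs_mul]
          exact (le_of_eq (by ring)).trans (le_abs_self _)
      _ ≤ (Cq * |p z.1|) * U * |e z.1| :=
          mul_le_mul_of_nonneg_right (mul_le_mul (hqp z.1) hz (abs_nonneg _) (by positivity))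
            (abs_nonneg _)
      _ = _ := by ring
  have h2 := abs_integral_mul_le (μ := volume.restrict (unitCube d)) (f := fun x => |p x|)
    (g := fun x => |e x|)
    (Continuous.integrableOn_unitCube (by fun_prop))
    (Continuous.integrableOn_unitCube (by fun_prop))
    (Continuous.integrableOn_unitCube (by fun_prop))
  simp only [sq_abs] at h2
  refine h1.trans ?_
  rw [integral_const_mul, integral_volQ_mul T (fun x => |p x| * |e x|) (fun _ => 1)]
  have h3 : ∫ _t in Set.Ioc (0 : ℝ) T, (1 : ℝ) = T := by simp [hT]
  rw [h3, mul_assoc (Cq * U), mul_comm T]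
  exact mul_le_mul_of_nonneg_left (mul_le_mul_of_nonneg_right ((le_abs_self _).trans h2) hT)
    (mul_nonneg hCq hU0)

/-- Control of the potential perturbation by the forcing, after truncating at frequency `N`. -/
lemma exists_potential_bound {T m c Cq S Cθ : ℝ} (hT : 0 < T) (hm : 0 < m) (hc : 0 < c)
    (hCq : 0 ≤ Cq) (hCθ : 0 ≤ Cθ) {us : (Fin d → ℝ) → ℝ → ℝ} (hus : SmoothQ us)
    (hlow : ∀ x, ∀ t ∈ Set.Icc 0 T, m ≤ us x t) (A B : ℝ) (β : ℕ) :
    ∃ K ≥ (0 : ℝ), ∀ (q p : (Fin d → ℝ) → ℝ) (τ δ N : ℝ), Continuous q →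
      ContDiff ℝ (⊤ : ℕ∞) p → ZPer p → 0 ≤ δ → 1 ≤ N → |τ| ≤ Cθ * δ →
      (∀ x, c * p x ^ 2 ≤ q x * p x) → (∀ x, |q x| ≤ Cq * |p x|) → topSq β p ≤ S →
      ForcingBound T A B τ δ q us →
      √(∫ x in unitCube d, p x ^ 2) ≤ K * (δ * N ^ 2 + (N ^ β)⁻¹) := by
  obtain ⟨C, -, htrunc⟩ := exists_truncation d
  have husc := hus.cont
  obtain ⟨U, hU0, hU⟩ := exists_abs_le_volQ T
    (by fun_prop : Continuous fun z : (Fin d → ℝ) × ℝ => (T - z.2) * us z.1 z.2)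
  set G := √(∫ z, lap (fun y => us y z.2) z.1 ^ 2 ∂volQ d T) with hG
  set D := √(3 * (A ^ 2 * T ^ 3 + B ^ 2 * T ^ 3 * C ^ 2 + T)) with hD
  set K₁ := Cθ / 2 * G * √(T ^ 3) + D with hK₁
  set K₂ := Cq * U * T * √S with hK₂
  have hK₁0 : 0 ≤ K₁ := by positivity
  have hK₂0 : 0 ≤ K₂ := by positivity
  set a := c * m * (T ^ 2 / 2) with ha
  have ha0 : 0 < a := by positivity
  refine ⟨(K₁ + K₂) / a, by positivity, fun q p τ δ N hq hp hper hδ hN hτ hqp hqp2 hS hF => ?_⟩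
  obtain ⟨φ, hφ, hφper, hφP, hφL, hφE⟩ := htrunc β p hp hper N hN
  set P := ∫ x in unitCube d, p x ^ 2 with hP
  have hP0 : 0 ≤ P := integral_nonneg fun x => sq_nonneg _
  set s := √P with hs
  have hs2 : s * s = P := Real.mul_self_sqrt hP0
  have hs0 : 0 ≤ s := Real.sqrt_nonneg _
  have hψ : SmoothQ fun (x : Fin d → ℝ) t => (T - t) * φ x :=
    (SmoothQ.of_time (by fun_prop)).mul (SmoothQ.of_space hφ)
  have hψper : ZPerSpace fun (x : Fin d → ℝ) t => (T - t) * φ x :=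
    (ZPerSpace.of_time _).mul (ZPerSpace.of_space hφper)
  have hforce := hF _ hψ hψper fun x => by simp
  have hpc := hp.continuous
  have hφc := hφ.continuous
  have hlapc := hus.lap.cont
  have htest : √(testSq T A B fun x t => (T - t) * φ x) ≤ D * N ^ 2 * s := by
    refine Real.sqrt_le_iff.2 ⟨by positivity, (testSq_linear_le hT.le hN hφP hφL).trans ?_⟩
    rw [mul_pow, mul_pow, hD, Real.sq_sqrt (by positivity), sq s, hs2]
  have hψ2 : √(∫ z : (Fin d → ℝ) × ℝ, ((T - z.2) * φ z.1) ^ 2 ∂volQ d T) ≤ √(T ^ 3) * s := by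
    rw [hs, ← Real.sqrt_mul (by positivity)]
    refine Real.sqrt_le_sqrt ?_
    simp only [mul_pow, mul_comm ((T - _) ^ 2)]
    rw [integral_volQ_mul T (fun x => φ x ^ 2) (fun t => (T - t) ^ 2), mul_comm]
    exact mul_le_mul (integral_Ioc_sub_sq_le hT.le) hφP (integral_nonneg fun x => sq_nonneg _)
      (by positivity)
  have hlap : |∫ z, lap (fun y => us y z.2) z.1 * ((T - z.2) * φ z.1) ∂volQ d T| ≤
      G * (√(T ^ 3) * s) :=
    (abs_integral_mul_le (integrable_volQ T (by fun_prop)) (integrable_volQ T (by fun_prop))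
      (integrable_volQ T (by fun_prop))).trans
      (mul_le_mul_of_nonneg_left hψ2 (Real.sqrt_nonneg _))
  have herr := integral_potential_error hT.le hCq hU0 hus hU hq hpc (hpc.fun_sub hφc) hqp2
  have hE : √(∫ x in unitCube d, (p x - φ x) ^ 2) ≤ (N ^ β)⁻¹ * √S := by
    refine (Real.sqrt_le_sqrt (hφE.trans (mul_le_mul_of_nonneg_left hS (by positivity)))).trans ?_
    rw [Real.sqrt_mul (by positivity), mul_comm 2 β, pow_mul, ← inv_pow,
      Real.sqrt_sq (by positivity)]
  have hlower := integral_potential_lower_bound hT.le hc.le hus hm.le hlow hq hpc hqp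
  have hsplit : ∫ z, q z.1 * us z.1 z.2 * ((T - z.2) * p z.1) ∂volQ d T =
      τ / 2 * (∫ z, lap (fun y => us y z.2) z.1 * ((T - z.2) * φ z.1) ∂volQ d T) -
      (∫ z, (τ / 2 * lap (fun y => us y z.2) z.1 - q z.1 * us z.1 z.2) * ((T - z.2) * φ z.1)
        ∂volQ d T) +
      ∫ z, q z.1 * us z.1 z.2 * ((T - z.2) * (p z.1 - φ z.1)) ∂volQ d T := by
    rw [← integral_const_mul, ← integral_sub (integrable_volQ T (by fun_prop))
      (integrable_volQ T (by fun_prop)), ← integral_add (integrable_volQ T (by fun_prop))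
      (integrable_volQ T (by fun_prop))]
    congr 1
    ext z
    ring
  have hb1 : τ / 2 * (∫ z, lap (fun y => us y z.2) z.1 * ((T - z.2) * φ z.1) ∂volQ d T) ≤
      Cθ * δ / 2 * (G * (√(T ^ 3) * s)) := by
    refine (le_abs_self _).trans ?_
    rw [abs_mul, abs_div, abs_two]
    exact mul_le_mul (by linarith) hlap (abs_nonneg _) (by positivity)
  have hb2 := (neg_le_abs _).trans (hforce.trans (mul_le_mul_of_nonneg_left htest hδ))
  have hb3 := herr.trans (mul_le_mul_of_nonneg_left (mul_le_mul_of_nonneg_left hE hs0)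
    (by positivity))
  have hN2 : 1 ≤ N ^ 2 := one_le_pow₀ hN
  have hb4 : Cθ * δ / 2 * (G * (√(T ^ 3) * s)) ≤ Cθ * δ / 2 * (G * (√(T ^ 3) * s)) * N ^ 2 :=
    le_mul_of_one_le_right (by positivity) hN2
  have hN0 : 0 ≤ (N ^ β)⁻¹ := by positivity
  have hδN : 0 ≤ δ * N ^ 2 := by positivity
  have key : a * s * s ≤ (K₁ + K₂) * (δ * N ^ 2 + (N ^ β)⁻¹) * s := by
    have h1 : a * s * s ≤ (K₁ * (δ * N ^ 2) + K₂ * (N ^ β)⁻¹) * s := by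
      rw [mul_assoc, hs2, hK₁, hK₂]
      linear_combination hlower + hsplit + hb1 + hb2 + hb3 + hb4
    refine h1.trans (mul_le_mul_of_nonneg_right ?_ hs0)
    linear_combination mul_nonneg hK₁0 hN0 + mul_nonneg hK₂0 hδN
  rcases hs0.eq_or_lt with h0 | h0
  · rw [← h0]; positivity
  · rw [div_mul_eq_mul_div, le_div_iff₀ ha0, mul_comm]
    exact le_of_mul_le_mul_right key h0

end Potential

section Stability

/-- Optimisation of the truncation frequency. -/
lemma truncation_rate (β : ℕ) {δ : ℝ} (hδ : 0 < δ) (hδ1 : δ ≤ 1) :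
    ∃ N : ℝ, 1 ≤ N ∧ δ * N ^ 2 = δ ^ ((β : ℝ) / (β + 2)) ∧
      (N ^ β)⁻¹ = δ ^ ((β : ℝ) / (β + 2)) := by
  have hβ : (0 : ℝ) < β + 2 := by positivity
  refine ⟨δ ^ (-(1 / ((β : ℝ) + 2))), ?_, ?_, ?_⟩
  · exact Real.one_le_rpow_of_pos_of_le_one_of_nonpos hδ hδ1 (neg_nonpos.2 (by positivity))
  · rw [← Real.rpow_natCast (δ ^ _) 2, ← Real.rpow_mul hδ.le]
    nth_rw 1 [← Real.rpow_one δ]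
    rw [← Real.rpow_add hδ]
    congr 1
    push_cast
    field_simp
    ring
  · rw [← Real.rpow_natCast (δ ^ _) β, ← Real.rpow_mul hδ.le, ← Real.rpow_neg hδ.le]
    congr 1
    field_simp

end Stability

/-- the stability estimate (Lemma `Stability Estimate`). -/
theorem stability_estimate {d : ℕ} (hd : 1 ≤ d) (T θmin θmax : ℝ)
    (hT : 0 < T) (hθmin : 0 < θmin) (hθ : θmin ≤ θmax) (Φ : LinkFun)
    (β : ℕ) (hβ : 2 + (d : ℝ) / 2 < (β : ℝ))
    (u0 : (Fin d → ℝ) → ℝ) (hu0 : ContDiff ℝ (⊤ : ℕ∞) u0) (hu0per : ZPer u0)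
    (u0min : ℝ) (hu0min : 0 < u0min) (hu0ge : ∀ x, u0min ≤ u0 x)
    (θ₀ : ℝ) (hθ₀ : θ₀ ∈ Set.Icc θmin θmax)
    (F₀ : (Fin d → ℝ) → ℝ) (hF₀ : ContDiff ℝ (⊤ : ℕ∞) F₀) (hF₀per : ZPer F₀)
    (ustar : (Fin d → ℝ) → ℝ → ℝ)
    (hustar : HeatSol T θ₀ (fun x => Φ.toFun (F₀ x)) u0 ustar)
    (hnoeig : ¬ ∃ lam : ℝ, ∀ x,
      θ₀ / 2 * lap u0 x - Φ.toFun (F₀ x) * u0 x = lam * u0 x) :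
    ∀ R > (0 : ℝ), ∃ L > (0 : ℝ), ∃ δ₀ > (0 : ℝ), ∀ δ : ℝ, 0 < δ → δ ≤ δ₀ →
      ∀ θ ∈ Set.Icc θmin θmax, ∀ F : (Fin d → ℝ) → ℝ,
        ContDiff ℝ (⊤ : ℕ∞) F → ZPer F → hSob β F ≤ R →
        ∀ u : (Fin d → ℝ) → ℝ → ℝ,
          HeatSol T θ (fun x => Φ.toFun (F x)) u0 u →
          l2Q T (fun x t => u x t - ustar x t) ≤ δ →
          |θ - θ₀| + l2T (fun x => F x - F₀ x)
            ≤ L * δ ^ ((β : ℝ) / ((β : ℝ) + 2)) := by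
  intro R hR
  have hu0pos : ∀ x, 0 < u0 x := fun x => hu0min.trans_le (hu0ge x)
  obtain ⟨T', hT', hT'T, hlow⟩ := exists_time_lower_bound (m := u0min / 2) hT hustar.1.cont
    hustar.2.1 fun x => by rw [hustar.2.2.2]; linarith [hu0ge x]
  have hus' := hustar.mono hT'T
  have hW : ∃ x, ∃ t ∈ Set.Ioo 0 T', lapWronskian ustar x t ≠ 0 := by
    by_contra! h
    exact hnoeig (eigenfunction_of_lapWronskian_eq_zero hT' (hθmin.trans_le hθ₀.1) hu0 hu0pos hus'
      (fun x t ht => (half_pos hu0min).trans_le (hlow x t ht)) h)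
  have hdβ : d < 2 * β := by
    have : (d : ℝ) < 2 * β := by linarith
    exact_mod_cast this
  obtain ⟨Cs, -, hsup⟩ := exists_sup_le hdβ
  set M := max (Cs + R ^ 2 + d * R ^ 2)
    (Cs + (∫ y in unitCube d, F₀ y ^ 2) + topSq β F₀)
  obtain ⟨c, hc, C, hC, hΦC, hΦ⟩ := Φ.exists_bounds M
  obtain ⟨K₁, hK₁, hdiff⟩ := exists_diffusivity_bound hT' hustar.1 hustar.2.1 hW C θmax
  obtain ⟨K₂, hK₂, hpot⟩ := exists_potential_bound (S := 2 * (d * R ^ 2) + 2 * topSq β F₀) hT'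
    (half_pos hu0min) hc hC.le hK₁ hustar.1 hlow C θmax β
  refine ⟨K₁ + 2 * K₂ + 1, by positivity, 1, one_pos, ?_⟩
  intro δ hδ hδ1 θ hθ F hF hFper hFR u hu hle
  have htop := topSq_le_of_hSob_le hFR
  have hFM : ∀ x, |F x| ≤ M := fun x => by
    refine le_trans ?_ (le_max_left _ _)
    linarith [hsup F hF hFper x, integral_sq_le_of_hSob_le hFR]
  have hF₀M : ∀ x, |F₀ x| ≤ M := fun x => (hsup F₀ hF₀ hF₀per x).trans (le_max_right _ _)
  have hΦF : ContDiff ℝ (⊤ : ℕ∞) fun x => Φ.toFun (F x) := Φ.smooth.comp hF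
  have hΦF₀ : ContDiff ℝ (⊤ : ℕ∞) fun x => Φ.toFun (F₀ x) := Φ.smooth.comp hF₀
  have hq := hΦF.sub hΦF₀
  have hforce : ForcingBound T' C θmax (θ - θ₀) δ
      (fun x => Φ.toFun (F x) - Φ.toFun (F₀ x)) ustar :=
    forcingBound_of_heatSol hT'.le hδ.le hΦF.continuous hΦF₀.continuous
      (fun x => hΦC _ (hFM x)) (abs_le.2 ⟨by linarith [hθ.1, hθ.2], hθ.2⟩) (hu.mono hT'T) hus'
      (integral_volQ_sq_le_of_l2Q_le hT'T (hu.1.sub hustar.1) hle)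
  have hτ := hdiff _ _ _ hq hforce
  obtain ⟨N, hN1, hN2, hN3⟩ := truncation_rate β hδ hδ1
  have hp := hpot _ (fun x => F x - F₀ x) _ _ N hq.continuous (hF.sub hF₀)
    (fun x k => congrArg₂ (· - ·) (hFper x k) (hF₀per x k)) hδ.le hN1 hτ
    (fun x => (hΦ _ _ (hFM x) (hF₀M x)).1) (fun x => (hΦ _ _ (hFM x) (hF₀M x)).2)
    (by linarith [topSq_sub_le hF hF₀ β]) hforce
  rw [hN2, hN3] at hp
  have hrate : δ ≤ δ ^ ((β : ℝ) / (β + 2)) := by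
    conv_lhs => rw [← Real.rpow_one δ]
    refine Real.rpow_le_rpow_of_exponent_ge hδ hδ1 ?_
    rw [div_le_one (by positivity)]
    linarith
  have h1 := hτ.trans (mul_le_mul_of_nonneg_left hrate hK₁)
  rw [l2T]
  linear_combination h1 + hp + Real.rpow_nonneg hδ.le ((β : ℝ) / (β + 2))
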